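/- Assume char(k) = p > 0. Let λ be a dominant weight of GL_n with mod-p reduction r(λ) = ε_1+...+ε_i. Then L(λ, G(n,r)) ≅ soc(Ω_r^i ⊗_k L(s(λ))^{[1]}) = im(d_i⊗id), where d_i: Ω_r^{i-1} → Ω_r^i is the de Rham differential. -/

import Mathlib

open MvPolynomial
open scoped TensorProduct MatrixGroups Classical

/-- `R(n,r) ⊗_k A`, i.e. `A[x_1,...,x_n]/(x_i^{p^r})` (with `q = p^r`). -/
abbrev Rq (A : Type) [CommRing A] (n q : ℕ) : Type :=
  MvPolynomial (Fin n) A ⧸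
    Ideal.span (Set.range fun i : Fin n => (X i : MvPolynomial (Fin n) A) ^ q)

/-- `λ_{j+1}` (with `λ_{n+1} = 0`), for a weight `λ` of `GL_n`. -/
def lamSucc (n : ℕ) (lam : Fin n → ℤ) (j : Fin n) : ℤ :=
  if h : (j : ℕ) + 1 < n then lam ⟨(j : ℕ) + 1, h⟩ else 0

/-- The coefficients `m_j` of `λ = Σ m_j(ε_1+...+ε_j)` reduced mod `p`. -/
def mcoef (p n : ℕ) (lam : Fin n → ℤ) (j : Fin n) : ℤ :=
  (lam j - lamSucc n lam j) % (p : ℤ)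

/-- The mod `p`-reduction `r(λ) ∈ X_1'(T)` of a dominant weight `λ`. -/
def rlam (p n : ℕ) (lam : Fin n → ℤ) (i : Fin n) : ℤ :=
  ∑ j ∈ Finset.univ.filter (fun j : Fin n => i ≤ j), mcoef p n lam j

/-- The generator `e_{a_1} ∧ ... ∧ e_{a_i}` of the exterior power `⋀^i(k^n)`
(`Λ^i U` with `U = k^n` the standard `GL_n`-representation). -/
noncomputable def wedgeGen (k : Type) [Field k] (n i : ℕ) (v : Fin i → (Fin n → k)) :
    ↥(⋀[k]^i (Fin n → k)) :=
  ⟨ExteriorAlgebra.ιMulti k i v, ExteriorAlgebra.ιMulti_range k i (Set.mem_range_self v)⟩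

/-- Invariance of a `k`-subspace of `R(n,r) ⊗ (Λ^{i}U ⊗ V)` under a family of
actions of the groups `G(n,r)(B) = Aut_B(R(n,r)_B)` for all commutative
`k`-algebras `B` (invariance of the `B`-span of its image under base change). -/
def InvPred (k : Type) [Field k] (n q i : ℕ) (Vs : Type) [AddCommGroup Vs] [Module k Vs]
    (ρI : ∀ (B : Type) [CommRing B] [Algebra k B],
      (Rq B n q ≃ₐ[B] Rq B n q) →*
        ((Rq B n q ⊗[k] ((↥(⋀[k]^i (Fin n → k))) ⊗[k] Vs)) ≃ₗ[B]
          (Rq B n q ⊗[k] ((↥(⋀[k]^i (Fin n → k))) ⊗[k] Vs))))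
    (W : Submodule k ((Rq k n q) ⊗[k] ((↥(⋀[k]^i (Fin n → k))) ⊗[k] Vs))) : Prop :=
  ∀ (B : Type) [CommRing B] [Algebra k B],
    ∀ θ : ((Rq k n q) ⊗[k] ((↥(⋀[k]^i (Fin n → k))) ⊗[k] Vs)) →ₗ[k]
        ((Rq B n q) ⊗[k] ((↥(⋀[k]^i (Fin n → k))) ⊗[k] Vs)),
      (∀ (P : MvPolynomial (Fin n) k) (w : (↥(⋀[k]^i (Fin n → k))) ⊗[k] Vs),
        θ (Ideal.Quotient.mk _ P ⊗ₜ[k] w) =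
          Ideal.Quotient.mk _ (MvPolynomial.map (algebraMap k B) P) ⊗ₜ[k] w) →
      ∀ (g : Rq B n q ≃ₐ[B] Rq B n q) (w : (Rq B n q) ⊗[k] ((↥(⋀[k]^i (Fin n → k))) ⊗[k] Vs)),
        w ∈ Submodule.span B (⇑θ '' (W : Set _)) →
        ρI B g w ∈ Submodule.span B (⇑θ '' (W : Set _))

theorem add_pow_char_pow_of_algebra (k : Type) [Field k] (p : ℕ) [Fact p.Prime] [CharP k p]
    {A : Type} [CommRing A] [Algebra k A] (m : ℕ) (x y : A) :
    (x + y) ^ p ^ m = x ^ p ^ m + y ^ p ^ m := by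
  rcases subsingleton_or_nontrivial A with h | h
  · exact Subsingleton.elim _ _
  · have : CharP A p := charP_of_injective_algebraMap (algebraMap k A).injective p
    exact add_pow_char_pow x y p m

/-- The Frobenius endomorphism of a (possibly trivial) algebra over a field of characteristic
`p`. -/
def algFrobenius (k : Type) [Field k] (p : ℕ) [Fact p.Prime] [CharP k p]
    (A : Type) [CommRing A] [Algebra k A] (m : ℕ) : A →+* A where
  toFun x := x ^ p ^ m
  map_one' := one_pow _
  map_mul' x y := mul_pow x y _
  map_zero' := zero_pow (pow_ne_zero _ (Fact.out : p.Prime).ne_zero)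
  map_add' := add_pow_char_pow_of_algebra k p m

theorem algFrobenius_apply (k : Type) [Field k] (p : ℕ) [Fact p.Prime] [CharP k p]
    (A : Type) [CommRing A] [Algebra k A] (m : ℕ) (x : A) :
    algFrobenius k p A m x = x ^ p ^ m := rfl

theorem charP_cast_eq_zero_of_algebra (k : Type) [Field k] (p : ℕ) [CharP k p]
    (A : Type) [CommRing A] [Algebra k A] : (p : A) = 0 := by
  rw [← map_natCast (algebraMap k A), CharP.cast_eq_zero, map_zero]

/-- The truncation ideal `(x_1^q, …, x_n^q)`. -/
noncomputable abbrev truncIdeal (A : Type) [CommRing A] (n q : ℕ) : Ideal (MvPolynomial (Fin n) A) :=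
  Ideal.span (Set.range fun i : Fin n => (X i : MvPolynomial (Fin n) A) ^ q)

theorem mk_X_pow {A : Type} [CommRing A] (n q : ℕ) (j : Fin n) :
    (Ideal.Quotient.mk (truncIdeal A n q) (X j)) ^ q = 0 := by
  rw [← map_pow, Ideal.Quotient.eq_zero_iff_mem]
  exact Ideal.subset_span ⟨j, rfl⟩

theorem pderiv_mem_truncIdeal {A : Type} [CommRing A] {n q : ℕ} (hq : (q : A) = 0) (j : Fin n)
    {P : MvPolynomial (Fin n) A} (hP : P ∈ truncIdeal A n q) :
    pderiv j P ∈ truncIdeal A n q := by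
  refine Submodule.span_induction (p := fun P _ => pderiv j P ∈ truncIdeal A n q)
    ?_ ?_ ?_ ?_ hP
  · rintro _ ⟨i, rfl⟩
    have : pderiv j ((X i : MvPolynomial (Fin n) A) ^ q) = 0 := by
      rw [Derivation.leibniz_pow, ← Nat.cast_smul_eq_nsmul A, hq, zero_smul]
    simp only [this, Submodule.zero_mem]
  · simp
  · intro x y _ _ hx hy
    rw [map_add]; exact add_mem hx hy
  · intro a x hx h
    rw [smul_eq_mul, Derivation.leibniz, smul_eq_mul, smul_eq_mul]
    exact add_mem (Ideal.mul_mem_left _ _ h) (Ideal.mul_mem_right _ _ hx)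

theorem mk_pderiv_congr {A : Type} [CommRing A] {n q : ℕ} (hq : (q : A) = 0) (j : Fin n)
    {P Q : MvPolynomial (Fin n) A}
    (h : Ideal.Quotient.mk (truncIdeal A n q) P = Ideal.Quotient.mk (truncIdeal A n q) Q) :
    Ideal.Quotient.mk (truncIdeal A n q) (pderiv j P) =
      Ideal.Quotient.mk (truncIdeal A n q) (pderiv j Q) := by
  rw [Ideal.Quotient.mk_eq_mk_iff_sub_mem] at h ⊢
  rw [← map_sub]
  exact pderiv_mem_truncIdeal hq j h

theorem pderiv_aeval {A : Type} [CommRing A] {n : ℕ} (Pg : Fin n → MvPolynomial (Fin n) A)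
    (b : Fin n) (P : MvPolynomial (Fin n) A) :
    pderiv b (aeval Pg P) = ∑ j, aeval Pg (pderiv j P) * pderiv b (Pg j) := by
  induction P using MvPolynomial.induction_on with
  | C a => simp
  | add P Q hP hQ => simp only [map_add, hP, hQ, add_mul, Finset.sum_add_distrib]
  | mul_X P i hP =>
    simp only [map_mul, aeval_X, Derivation.leibniz, smul_eq_mul, hP, pderiv_X, map_add, add_mul,
      Finset.sum_add_distrib, Finset.mul_sum]
    congr 1
    · rw [Finset.sum_eq_single i]
      · simp
      · intro j _ hj; simp [hj]
      · simp
    · exact Finset.sum_congr rfl fun j _ => by ring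

theorem mk_aeval_eq {A : Type} [CommRing A] {n q : ℕ} (g : Rq A n q →ₐ[A] Rq A n q)
    (Pg : Fin n → MvPolynomial (Fin n) A)
    (h : ∀ j, Ideal.Quotient.mk (truncIdeal A n q) (Pg j) =
      g (Ideal.Quotient.mk (truncIdeal A n q) (X j))) (P : MvPolynomial (Fin n) A) :
    Ideal.Quotient.mk (truncIdeal A n q) (aeval Pg P) =
      g (Ideal.Quotient.mk (truncIdeal A n q) P) := by
  have : (Ideal.Quotient.mkₐ A (truncIdeal A n q)).comp (aeval Pg) =
      g.comp (Ideal.Quotient.mkₐ A (truncIdeal A n q)) := by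
    ext j; simpa using h j
  exact DFunLike.congr_fun this P

theorem mk_pderiv_aeval {A : Type} [CommRing A] {n q : ℕ} (g : Rq A n q →ₐ[A] Rq A n q)
    (Pg : Fin n → MvPolynomial (Fin n) A)
    (h : ∀ j, Ideal.Quotient.mk (truncIdeal A n q) (Pg j) =
      g (Ideal.Quotient.mk (truncIdeal A n q) (X j))) (b : Fin n) (P : MvPolynomial (Fin n) A) :
    Ideal.Quotient.mk (truncIdeal A n q) (pderiv b (aeval Pg P)) =
      ∑ j, g (Ideal.Quotient.mk (truncIdeal A n q) (pderiv j P)) *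
        Ideal.Quotient.mk (truncIdeal A n q) (pderiv b (Pg j)) := by
  rw [pderiv_aeval, map_sum]
  exact Finset.sum_congr rfl fun j _ => by rw [map_mul, mk_aeval_eq g Pg h]

/-- The Jacobian matrix of an automorphism of the truncated polynomial ring. -/
theorem exists_jacobian {A : Type} [CommRing A] {n q : ℕ} (hq : (q : A) = 0)
    (g : Rq A n q ≃ₐ[A] Rq A n q) (Pg : Fin n → MvPolynomial (Fin n) A)
    (h : ∀ j, Ideal.Quotient.mk (truncIdeal A n q) (Pg j) =
      g (Ideal.Quotient.mk (truncIdeal A n q) (X j))) :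
    ∃ J : GL (Fin n) (Rq A n q), ∀ a b, (J : Matrix (Fin n) (Fin n) (Rq A n q)) a b =
      Ideal.Quotient.mk (truncIdeal A n q) (pderiv a (Pg b)) := by
  choose Q hQ using fun j => Ideal.Quotient.mk_surjective
    (g.symm (Ideal.Quotient.mk (truncIdeal A n q) (X j)))
  let J : Matrix (Fin n) (Fin n) (Rq A n q) :=
    fun a b => Ideal.Quotient.mk (truncIdeal A n q) (pderiv a (Pg b))
  let K : Matrix (Fin n) (Fin n) (Rq A n q) :=
    fun a b => g (Ideal.Quotient.mk (truncIdeal A n q) (pderiv a (Q b)))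
  have hJK : J * K = 1 := by
    ext a b
    have h1 := mk_pderiv_aeval (g : Rq A n q →ₐ[A] Rq A n q) Pg h a (Q b)
    have h2 : Ideal.Quotient.mk (truncIdeal A n q) (aeval Pg (Q b)) =
        Ideal.Quotient.mk (truncIdeal A n q) (X b) := by
      rw [mk_aeval_eq (g : Rq A n q →ₐ[A] Rq A n q) Pg h, hQ]
      exact g.apply_symm_apply _
    rw [mk_pderiv_congr hq a h2, pderiv_X] at h1
    rw [Matrix.mul_apply, Matrix.one_apply]
    calc ∑ j, J a j * K j b = _ := Finset.sum_congr rfl fun j _ => mul_comm _ _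
      _ = _ := h1.symm
      _ = _ := by
        rcases eq_or_ne a b with rfl | hab
        · simp
        · simp [hab, hab.symm]
  exact ⟨⟨J, K, hJK, mul_eq_one_comm.mp hJK⟩, fun a b => rfl⟩

/-- The endomorphism of the truncated polynomial ring given by the images of the variables. -/
theorem exists_truncHom {A : Type} [CommRing A] {n q : ℕ} (Pg : Fin n → MvPolynomial (Fin n) A)
    (h : ∀ j, (Ideal.Quotient.mk (truncIdeal A n q) (Pg j)) ^ q = 0) :
    ∃ g : Rq A n q →ₐ[A] Rq A n q, ∀ j,
      Ideal.Quotient.mk (truncIdeal A n q) (Pg j) =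
      g (Ideal.Quotient.mk (truncIdeal A n q) (X j)) := by
  refine ⟨Ideal.Quotient.liftₐ (truncIdeal A n q)
    (aeval fun j => Ideal.Quotient.mk (truncIdeal A n q) (Pg j)) ?_, ?_⟩
  · intro a ha
    have : truncIdeal A n q ≤ RingHom.ker
        (aeval (R := A) fun j => Ideal.Quotient.mk (truncIdeal A n q) (Pg j) :
          MvPolynomial (Fin n) A →ₐ[A] Rq A n q) := by
      rw [Ideal.span_le]
      rintro _ ⟨i, rfl⟩
      rw [SetLike.mem_coe, RingHom.mem_ker, map_pow, aeval_X]
      exact h i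
    exact this ha
  · intro j
    exact (aeval_X (R := A) (fun j => Ideal.Quotient.mk (truncIdeal A n q) (Pg j)) j).symm

theorem exists_truncAut {A : Type} [CommRing A] {n q : ℕ} (Pg Qg : Fin n → MvPolynomial (Fin n) A)
    (h : ∀ j, (Ideal.Quotient.mk (truncIdeal A n q) (Pg j)) ^ q = 0)
    (h' : ∀ j, (Ideal.Quotient.mk (truncIdeal A n q) (Qg j)) ^ q = 0)
    (hPQ : ∀ j, aeval Pg (Qg j) = X j) (hQP : ∀ j, aeval Qg (Pg j) = X j) :
    ∃ g : Rq A n q ≃ₐ[A] Rq A n q, ∀ j,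
      Ideal.Quotient.mk (truncIdeal A n q) (Pg j) =
      g (Ideal.Quotient.mk (truncIdeal A n q) (X j)) := by
  obtain ⟨g, hg⟩ := exists_truncHom Pg h
  obtain ⟨g', hg'⟩ := exists_truncHom Qg h'
  refine ⟨AlgEquiv.ofAlgHom g g' ?_ ?_, hg⟩
  · refine Ideal.Quotient.algHom_ext A (MvPolynomial.algHom_ext fun j => ?_)
    change g (g' (Ideal.Quotient.mk (truncIdeal A n q) (X j))) =
      Ideal.Quotient.mk (truncIdeal A n q) (X j)
    rw [← hg', ← mk_aeval_eq g Pg hg, hPQ]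
  · refine Ideal.Quotient.algHom_ext A (MvPolynomial.algHom_ext fun j => ?_)
    change g' (g (Ideal.Quotient.mk (truncIdeal A n q) (X j))) =
      Ideal.Quotient.mk (truncIdeal A n q) (X j)
    rw [← hg, ← mk_aeval_eq g' Qg hg', hQP]

section BaseChange

variable {k : Type} [Field k] {n q : ℕ}

/-- The base change map `R(n,r) → R(n,r)_B`. -/
noncomputable def baseHom (k : Type) [Field k] (n q : ℕ) (B : Type) [CommRing B] [Algebra k B] :
    Rq k n q →ₐ[k] Rq B n q :=
  Ideal.Quotient.liftₐ (truncIdeal k n q)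
    (((Ideal.Quotient.mkₐ B (truncIdeal B n q)).restrictScalars k).comp
      (aeval (R := k) (X : Fin n → MvPolynomial (Fin n) B))) (by
    intro a ha
    have : truncIdeal k n q ≤ RingHom.ker
        (((Ideal.Quotient.mkₐ B (truncIdeal B n q)).restrictScalars k).comp
          (aeval (R := k) (X : Fin n → MvPolynomial (Fin n) B))) := by
      rw [Ideal.span_le]
      rintro _ ⟨i, rfl⟩
      rw [SetLike.mem_coe, RingHom.mem_ker, map_pow, AlgHom.comp_apply, aeval_X]
      exact mk_X_pow n q i
    exact this ha)

theorem baseHom_mk (B : Type) [CommRing B] [Algebra k B] (P : MvPolynomial (Fin n) k) :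
    baseHom k n q B (Ideal.Quotient.mk (truncIdeal k n q) P) =
      Ideal.Quotient.mk (truncIdeal B n q) (MvPolynomial.map (algebraMap k B) P) := by
  have : (aeval (R := k) (X : Fin n → MvPolynomial (Fin n) B)) P =
      MvPolynomial.map (algebraMap k B) P := by
    induction P using MvPolynomial.induction_on with
    | C a => rw [map_C]; exact aeval_C _ _
    | add P Q hP hQ => rw [map_add, map_add, hP, hQ]
    | mul_X P i hP => rw [map_mul, map_mul, hP, aeval_X, map_X]
  exact congrArg (Ideal.Quotient.mk (truncIdeal B n q)) this

/-- Applying a `k`-linear functional on `B` to the coefficients of a polynomial. -/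
noncomputable def coefPoly {B : Type} [CommRing B] [Algebra k B] (n : ℕ) (ℓ : B →ₗ[k] k) :
    MvPolynomial (Fin n) B →ₗ[k] MvPolynomial (Fin n) k :=
  (TensorProduct.lid k (MvPolynomial (Fin n) k)).toLinearMap ∘ₗ
    (ℓ.rTensor (MvPolynomial (Fin n) k)) ∘ₗ
      ((algebraTensorAlgEquiv (σ := Fin n) k B).symm.toLinearEquiv.restrictScalars k).toLinearMap

theorem coefPoly_smul_map {B : Type} [CommRing B] [Algebra k B] (ℓ : B →ₗ[k] k) (b : B)
    (P : MvPolynomial (Fin n) k) :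
    coefPoly n ℓ (b • MvPolynomial.map (algebraMap k B) P) = ℓ b • P := by
  rw [← algebraTensorAlgEquiv_tmul]
  simp only [coefPoly, LinearMap.comp_apply, LinearEquiv.coe_coe,
    LinearEquiv.restrictScalars_apply, AlgEquiv.toLinearEquiv_apply,
    AlgEquiv.symm_apply_apply, LinearMap.rTensor_tmul, TensorProduct.lid_tmul]

theorem coefPoly_mul_map {B : Type} [CommRing B] [Algebra k B] (ℓ : B →ₗ[k] k)
    (Q : MvPolynomial (Fin n) B) (P : MvPolynomial (Fin n) k) :
    coefPoly n ℓ (Q * MvPolynomial.map (algebraMap k B) P) = coefPoly n ℓ Q * P := by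
  obtain ⟨z, rfl⟩ := (algebraTensorAlgEquiv (σ := Fin n) k B).surjective Q
  induction z using TensorProduct.induction_on with
  | zero => simp
  | tmul b P' =>
    rw [algebraTensorAlgEquiv_tmul, smul_mul_assoc, ← map_mul, coefPoly_smul_map,
      coefPoly_smul_map, smul_mul_assoc]
  | add x y hx hy => rw [map_add, add_mul, map_add, hx, hy, map_add, add_mul]

theorem coefPoly_mem {B : Type} [CommRing B] [Algebra k B] (ℓ : B →ₗ[k] k)
    {y : MvPolynomial (Fin n) B} (hy : y ∈ truncIdeal B n q) :
    coefPoly n ℓ y ∈ truncIdeal k n q := by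
  suffices h : ∀ Q, coefPoly n ℓ (Q * y) ∈ truncIdeal k n q by simpa using h 1
  refine Submodule.span_induction
    (p := fun y _ => ∀ Q, coefPoly n ℓ (Q * y) ∈ truncIdeal k n q) ?_ ?_ ?_ ?_ hy
  · rintro _ ⟨i, rfl⟩ Q
    have := coefPoly_mul_map ℓ Q (X i ^ q)
    rw [map_pow, map_X] at this
    rw [this]
    exact Ideal.mul_mem_left _ _ (Ideal.subset_span ⟨i, rfl⟩)
  · intro Q; simp
  · intro x y _ _ hx hy Q
    rw [mul_add, map_add]; exact add_mem (hx Q) (hy Q)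
  · intro a x _ hx Q
    rw [smul_eq_mul, ← mul_assoc]; exact hx _

/-- Applying a `k`-linear functional on `B` to the coefficients of an element of `R(n,r)_B`. -/
noncomputable def coefMap {B : Type} [CommRing B] [Algebra k B] (n q : ℕ) (ℓ : B →ₗ[k] k) :
    Rq B n q →ₗ[k] Rq k n q :=
  (Submodule.mapQ ((truncIdeal B n q).restrictScalars k) ((truncIdeal k n q).restrictScalars k)
    (coefPoly n ℓ) fun _ hy => coefPoly_mem ℓ hy)

theorem coefMap_mk {B : Type} [CommRing B] [Algebra k B] (ℓ : B →ₗ[k] k)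
    (P : MvPolynomial (Fin n) B) :
    coefMap n q ℓ (Ideal.Quotient.mk (truncIdeal B n q) P) =
      Ideal.Quotient.mk (truncIdeal k n q) (coefPoly n ℓ P) := rfl

theorem coefMap_smul_baseHom {B : Type} [CommRing B] [Algebra k B] (ℓ : B →ₗ[k] k) (b : B)
    (f : Rq k n q) : coefMap n q ℓ (b • baseHom k n q B f) = ℓ b • f := by
  obtain ⟨P, rfl⟩ := Ideal.Quotient.mk_surjective f
  rw [baseHom_mk]
  exact congrArg (Ideal.Quotient.mk (truncIdeal k n q)) (coefPoly_smul_map ℓ b P)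

variable {T : Type} [AddCommMonoid T] [Module k T]

theorem coefMap_rTensor_smul {B : Type} [CommRing B] [Algebra k B] (ℓ : B →ₗ[k] k) (b : B)
    (w : Rq k n q ⊗[k] T) :
    (coefMap n q ℓ).rTensor T (b • (baseHom k n q B).toLinearMap.rTensor T w) = ℓ b • w := by
  induction w using TensorProduct.induction_on with
  | zero => simp
  | tmul f t =>
    rw [LinearMap.rTensor_tmul, TensorProduct.smul_tmul', LinearMap.rTensor_tmul,
      AlgHom.toLinearMap_apply, coefMap_smul_baseHom, TensorProduct.smul_tmul']
  | add x y hx hy => rw [map_add, smul_add, map_add, hx, hy, smul_add]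

theorem coefMap_rTensor_smul_left {B : Type} [CommRing B] [Algebra k B] (ℓ : B →ₗ[k] k) (b : B)
    (x : Rq B n q ⊗[k] T) :
    (coefMap n q ℓ).rTensor T (b • x) =
      (coefMap n q (ℓ ∘ₗ LinearMap.mul k B b)).rTensor T x := by
  induction x using TensorProduct.induction_on with
  | zero => simp
  | tmul f t =>
    rw [TensorProduct.smul_tmul', LinearMap.rTensor_tmul, LinearMap.rTensor_tmul]
    congr 1
    obtain ⟨P, rfl⟩ := Ideal.Quotient.mk_surjective f
    change coefMap n q ℓ (Ideal.Quotient.mk (truncIdeal B n q) (b • P)) = _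
    rw [coefMap_mk, coefMap_mk]
    congr 1
    obtain ⟨z, rfl⟩ := (algebraTensorAlgEquiv (σ := Fin n) k B).surjective P
    rw [← map_smul]
    simp only [coefPoly, LinearMap.comp_apply, LinearEquiv.coe_coe,
      LinearEquiv.restrictScalars_apply, AlgEquiv.toLinearEquiv_apply,
      AlgEquiv.symm_apply_apply]
    congr 1
    induction z using TensorProduct.induction_on with
    | zero => simp
    | tmul c P' => simp [TensorProduct.smul_tmul']
    | add x y hx hy => rw [smul_add, map_add, hx, hy, map_add]
  | add x y hx hy => rw [smul_add, map_add, map_add, hx, hy]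

theorem coefMap_rTensor_mem {B : Type} [CommRing B] [Algebra k B] (ℓ : B →ₗ[k] k)
    (W : Submodule k (Rq k n q ⊗[k] T)) {z : Rq B n q ⊗[k] T}
    (hz : z ∈ Submodule.span B ((baseHom k n q B).toLinearMap.rTensor T '' (W : Set _))) :
    (coefMap n q ℓ).rTensor T z ∈ W := by
  induction hz using Submodule.span_induction generalizing ℓ with
  | mem x h =>
    obtain ⟨w, hw, rfl⟩ := h
    have := coefMap_rTensor_smul ℓ 1 w
    rw [one_smul] at this
    rw [this]; exact W.smul_mem _ hw
  | zero => simp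
  | add x y _ _ hx hy => rw [map_add]; exact W.add_mem (hx ℓ) (hy ℓ)
  | smul b x _ hx =>
    have := hx (ℓ ∘ₗ (LinearMap.mul k B b))
    rwa [← coefMap_rTensor_smul_left] at this

end BaseChange

section Wedge

theorem exists_notMem_range_of_ne {n i : ℕ} {a b : Fin i → Fin n} (ha : StrictMono a)
    (hb : StrictMono b) (hab : b ≠ a) : ∃ m, a m ∉ Set.range b := by
  by_contra! h
  apply hab
  have h1 : Finset.univ.image a ⊆ Finset.univ.image b := by
    intro x hx
    simp only [Finset.mem_image, Finset.mem_univ, true_and] at hx ⊢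
    obtain ⟨m, rfl⟩ := hx
    exact h m
  have h2 : Finset.univ.image a = Finset.univ.image b := by
    apply Finset.eq_of_subset_of_card_le h1
    rw [Finset.card_image_of_injective _ ha.injective,
      Finset.card_image_of_injective _ hb.injective]
  have h3 : Set.range a = Set.range b := by
    have := congrArg (fun s : Finset (Fin n) => (s : Set (Fin n))) h2
    simpa using this
  exact ((StrictMono.range_inj ha hb).mp h3).symm

variable (k : Type) [Field k] (n i : ℕ) (V : Type) [AddCommGroup V] [Module k V]

/-- `v ↦ e_{b_1} ∧ ⋯ ∧ e_{b_i} ⊗ v`. -/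
noncomputable def wedgeTensor (b : Fin i → Fin n) :
    V →ₗ[k] (↥(⋀[k]^i (Fin n → k))) ⊗[k] V :=
  TensorProduct.mk k (↥(⋀[k]^i (Fin n → k))) V (wedgeGen k n i (fun l => Pi.single (b l) 1))

variable {k n i V}

theorem wedgeTensor_apply (b : Fin i → Fin n) (v : V) :
    wedgeTensor k n i V b v = wedgeGen k n i (fun l => Pi.single (b l) 1) ⊗ₜ[k] v := rfl

theorem wedgeGen_eq_ιMulti (v : Fin i → (Fin n → k)) :
    wedgeGen k n i v = exteriorPower.ιMulti k i v := rfl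

theorem wedgeTensor_of_not_injective {b : Fin i → Fin n} (hb : ¬ Function.Injective b) :
    wedgeTensor k n i V b = 0 := by
  ext v
  rw [wedgeTensor_apply, wedgeGen_eq_ιMulti, AlternatingMap.map_eq_zero_of_not_injective,
    TensorProduct.zero_tmul, LinearMap.zero_apply]
  intro h
  exact hb fun x y hxy => h (congrArg (fun j => (Pi.single j 1 : Fin n → k)) hxy)

theorem sign_cast_mul_self (π : Equiv.Perm (Fin i)) :
    ((Equiv.Perm.sign π : ℤ) : k) * ((Equiv.Perm.sign π : ℤ) : k) = 1 := by
  rw [← Int.cast_mul, ← Units.val_mul, Int.units_mul_self, Units.val_one, Int.cast_one]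

theorem wedgeTensor_comp_perm (b : Fin i → Fin n) (π : Equiv.Perm (Fin i)) :
    wedgeTensor k n i V (b ∘ π) = ((Equiv.Perm.sign π : ℤ) : k) • wedgeTensor k n i V b := by
  ext v
  rw [LinearMap.smul_apply, wedgeTensor_apply, wedgeTensor_apply, wedgeGen_eq_ιMulti,
    wedgeGen_eq_ιMulti]
  have := (exteriorPower.ιMulti k i).map_perm (fun l => (Pi.single (b l) 1 : Fin n → k)) π
  rw [Function.comp_def] at this
  rw [Units.smul_def, ← Int.cast_smul_eq_zsmul k] at this
  rw [TensorProduct.smul_tmul', ← this]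
  rfl

theorem exists_perm_strictMono {a : Fin i → Fin n} (ha : Function.Injective a) :
    ∃ π : Equiv.Perm (Fin i), StrictMono (a ∘ π) :=
  ⟨Tuple.sort a, (Tuple.monotone_sort a).strictMono_of_injective
    (ha.comp (Tuple.sort a).injective)⟩

theorem span_wedgeTensor (z : (↥(⋀[k]^i (Fin n → k))) ⊗[k] V) :
    z ∈ Submodule.span k {t | ∃ (a : Fin i → Fin n) (v : V), StrictMono a ∧
      t = wedgeTensor k n i V a v} := by
  set S := Submodule.span k {t | ∃ (a : Fin i → Fin n) (v : V), StrictMono a ∧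
      t = wedgeTensor k n i V a v} with hS
  have hstrict : ∀ (a : Fin i → Fin n) (v : V), wedgeTensor k n i V a v ∈ S := by
    intro a v
    by_cases ha : Function.Injective a
    · obtain ⟨π, hπ⟩ := exists_perm_strictMono ha
      have : wedgeTensor k n i V a =
          ((Equiv.Perm.sign π : ℤ) : k) • wedgeTensor k n i V (a ∘ π) := by
        rw [wedgeTensor_comp_perm, smul_smul, sign_cast_mul_self, one_smul]
      rw [this, LinearMap.smul_apply]
      have hmem : wedgeTensor k n i V (a ∘ π) v ∈ S :=
        Submodule.subset_span ⟨_, v, hπ, rfl⟩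
      exact S.smul_mem _ hmem
    · rw [wedgeTensor_of_not_injective ha]; exact S.zero_mem
  induction z using TensorProduct.induction_on with
  | zero => exact S.zero_mem
  | add x y hx hy => exact S.add_mem hx hy
  | tmul x v =>
    have hx : x ∈ Submodule.span k (Set.range (exteriorPower.ιMulti k i (M := Fin n → k))) := by
      rw [exteriorPower.ιMulti_span]; trivial
    induction hx using Submodule.span_induction with
    | mem x h =>
      obtain ⟨y, rfl⟩ := h
      have h1 : y = fun m => ∑ j, y m j • (Pi.single j 1 : Fin n → k) := by
        ext m j
        simp [Finset.sum_apply, Pi.single_apply]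
      rw [h1]
      change (((exteriorPower.ιMulti k i).toMultilinearMap fun m => _) ⊗ₜ v) ∈ S
      rw [MultilinearMap.map_sum, TensorProduct.sum_tmul]
      refine S.sum_mem fun b _ => ?_
      rw [MultilinearMap.map_smul_univ, ← TensorProduct.smul_tmul']
      exact S.smul_mem _ (hstrict b v)
    | zero => rw [TensorProduct.zero_tmul]; exact S.zero_mem
    | add x y _ _ hx hy => rw [TensorProduct.add_tmul]; exact S.add_mem hx hy
    | smul c x _ hx => rw [← TensorProduct.smul_tmul']; exact S.smul_mem _ hx

variable (C : Type) [CommRing C] [Algebra k C]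

/-- The alternating map `(A_1, …, A_i) ↦ A_1 ∧ ⋯ ∧ A_i ⊗ s` with coefficients in `C`. -/
noncomputable def wedgeMap (s : C ⊗[k] V) :
    (Fin n → C) [⋀^Fin i]→ₗ[C] (C ⊗[k] ((↥(⋀[k]^i (Fin n → k))) ⊗[k] V)) :=
  ∑ b ∈ Finset.univ.filter (fun b : Fin i → Fin n => StrictMono b),
    (LinearMap.toSpanSingleton C _ ((wedgeTensor k n i V b).baseChange C s)).compAlternatingMap
      ((Matrix.detRowAlternating (R := C) (n := Fin i)).compLinearMap (LinearMap.funLeft C C b))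

variable {C}

theorem wedgeMap_apply (s : C ⊗[k] V) (A : Fin i → Fin n → C) :
    wedgeMap C s A = ∑ b ∈ Finset.univ.filter (fun b : Fin i → Fin n => StrictMono b),
      (Matrix.of fun m l => A m (b l)).det • (wedgeTensor k n i V b).baseChange C s := by
  change AlternatingMap.toMultilinearMapLM (R := C) (S := C) (wedgeMap C s) A = _
  rw [wedgeMap, map_sum, _root_.sum_apply]
  rfl

theorem wedgeMap_add (s t : C ⊗[k] V) (A : Fin i → Fin n → C) :
    wedgeMap C (s + t) A = wedgeMap C s A + wedgeMap C t A := by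
  simp only [wedgeMap_apply, map_add, smul_add, Finset.sum_add_distrib]

theorem wedgeMap_smul (c : C) (s : C ⊗[k] V) (A : Fin i → Fin n → C) :
    wedgeMap C (c • s) A = c • wedgeMap C s A := by
  simp only [wedgeMap_apply, map_smul, Finset.smul_sum, smul_comm c]

theorem wedgeMap_zero (A : Fin i → Fin n → C) :
    wedgeMap C (0 : C ⊗[k] V) A = 0 := by
  simp only [wedgeMap_apply, map_zero, smul_zero, Finset.sum_const_zero]

theorem det_single_of_ne {a b : Fin i → Fin n} (ha : StrictMono a) (hb : StrictMono b)
    (hab : b ≠ a) :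
    (Matrix.of fun m l => (Pi.single (a m) 1 : Fin n → C) (b l)).det = 0 := by
  obtain ⟨m, hm⟩ := exists_notMem_range_of_ne ha hb hab
  apply Matrix.det_eq_zero_of_row_eq_zero m
  intro l
  have : b l ≠ a m := fun h => hm ⟨l, h⟩
  simp [Pi.single_apply, this]

theorem wedgeMap_single (s : C ⊗[k] V) (a : Fin i → Fin n) :
    wedgeMap C s (fun m => Pi.single (a m) 1) = (wedgeTensor k n i V a).baseChange C s := by
  have key : ∀ a : Fin i → Fin n, StrictMono a →
      wedgeMap C s (fun m => Pi.single (a m) 1) = (wedgeTensor k n i V a).baseChange C s := by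
    intro a ha
    rw [wedgeMap_apply, Finset.sum_eq_single a]
    · have : (Matrix.of fun m l => (Pi.single (a m) 1 : Fin n → C) (a l)) = 1 := by
        ext m l
        simp [Matrix.one_apply, Pi.single_apply, ha.injective.eq_iff, eq_comm]
      rw [this, Matrix.det_one, one_smul]
    · intro b hb hba
      rw [det_single_of_ne ha (by simpa using hb) hba, zero_smul]
    · intro h; simp [ha] at h
  by_cases ha : Function.Injective a
  · obtain ⟨π, hπ⟩ := exists_perm_strictMono ha
    have h1 := key _ hπ
    have h2 := (wedgeMap C s).map_perm (fun m => (Pi.single (a m) 1 : Fin n → C)) π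
    rw [wedgeTensor_comp_perm] at h1
    replace h1 := h2.symm.trans h1
    rw [LinearMap.baseChange_smul, LinearMap.smul_apply, Units.smul_def,
      ← Int.cast_smul_eq_zsmul k] at h1
    have h3 := congrArg (((Equiv.Perm.sign π : ℤ) : k) • ·) h1
    simpa only [smul_smul, sign_cast_mul_self, one_smul] using h3
  · rw [wedgeTensor_of_not_injective ha, LinearMap.baseChange_zero, LinearMap.zero_apply]
    apply AlternatingMap.map_eq_zero_of_not_injective
    intro h
    exact ha fun x y hxy => h (congrArg (fun j => (Pi.single j 1 : Fin n → C)) hxy)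

theorem wedgeMap_expand (s : C ⊗[k] V) (A : Fin i → Fin n → C) :
    wedgeMap C s A = ∑ b : Fin i → Fin n,
      (∏ m, A m (b m)) • (wedgeTensor k n i V b).baseChange C s := by
  have h1 : A = fun m => ∑ j, A m j • (Pi.single j 1 : Fin n → C) := by
    ext m j
    simp [Finset.sum_apply, Pi.single_apply]
  conv_lhs => rw [h1]
  change (wedgeMap C s).toMultilinearMap _ = _
  rw [MultilinearMap.map_sum]
  refine Finset.sum_congr rfl fun b _ => ?_
  rw [MultilinearMap.map_smul_univ]
  congr 1
  exact wedgeMap_single s b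

end Wedge

theorem adjoinRoot_of_injective_of_monic {B : Type} [CommRing B] {f : Polynomial B}
    (hf : f.Monic) (hdeg : 0 < f.natDegree) : Function.Injective (AdjoinRoot.of f) := by
  rw [injective_iff_map_eq_zero]
  intro b hb
  by_contra hb0
  rw [AdjoinRoot.of, RingHom.comp_apply, AdjoinRoot.mk_eq_zero] at hb
  refine hf.not_dvd_of_natDegree_lt (by simpa using hb0) ?_ hb
  simpa using hdeg

theorem exists_pow_root_extension (k : Type) [Field k] {p : ℕ} (hp : p ≠ 0) (B : Type)
    [CommRing B] [Algebra k B] {ι : Type} (m : ι → B) (s : Finset ι) :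
    ∃ (C : Type) (_ : CommRing C) (_ : Algebra k C) (φ : B →ₐ[k] C),
      Function.Injective φ ∧ ∀ x ∈ s, ∃ y, y ^ p = φ (m x) := by
  induction s using Finset.induction_on with
  | empty => exact ⟨B, inferInstance, inferInstance, AlgHom.id k B, fun _ _ h => h, by simp⟩
  | insert a s _ ih =>
    obtain ⟨C, _, _, φ, hφ, hs⟩ := ih
    rcases subsingleton_or_nontrivial C with hC | hC
    · exact ⟨C, inferInstance, inferInstance, φ, hφ,
        fun x _ => ⟨0, Subsingleton.elim _ _⟩⟩
    let f : Polynomial C := Polynomial.X ^ p - Polynomial.C (φ (m a))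
    have hf : f.Monic := Polynomial.monic_X_pow_sub_C _ hp
    have hdeg : f.natDegree = p := Polynomial.natDegree_X_pow_sub_C
    have hinj := adjoinRoot_of_injective_of_monic hf (by omega)
    refine ⟨AdjoinRoot f, inferInstance, inferInstance,
      (AdjoinRoot.ofAlgHom k f).comp φ, hinj.comp hφ, ?_⟩
    intro x hx
    rcases Finset.mem_insert.mp hx with rfl | hx
    · refine ⟨AdjoinRoot.root f, ?_⟩
      have := AdjoinRoot.eval₂_root f
      rw [Polynomial.eval₂_sub, Polynomial.eval₂_X_pow, Polynomial.eval₂_C, sub_eq_zero] at this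
      exact this
    · obtain ⟨y, hy⟩ := hs x hx
      refine ⟨AdjoinRoot.of f y, ?_⟩
      rw [← map_pow, hy]
      rfl

theorem submatrix_det_mem_of_le {C : Type} [CommRing C] {n : ℕ} (N : Matrix (Fin n) (Fin n) C)
    (I : Ideal C) {j j' : ℕ} (hj : j ≤ j')
    (h : ∀ b a : Fin j → Fin n, (N.submatrix b a).det ∈ I) :
    ∀ b a : Fin j' → Fin n, (N.submatrix b a).det ∈ I := by
  induction j', hj using Nat.le_induction with
  | base => exact h
  | succ j' _ ih =>
    intro b a
    rw [Matrix.det_succ_row_zero]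
    refine I.sum_mem fun l _ => I.mul_mem_left _ ?_
    rw [Matrix.submatrix_submatrix]
    exact ih _ _

theorem ideal_eq_top_of_minors {C : Type} [CommRing C] {n j : ℕ} (hj : j ≤ n)
    (N : GL (Fin n) C) (I : Ideal C)
    (h : ∀ b a : Fin j → Fin n, StrictMono b →
      ((N : Matrix (Fin n) (Fin n) C).submatrix b a).det ∈ I) : I = ⊤ := by
  have h1 : ∀ b a : Fin j → Fin n,
      ((N : Matrix (Fin n) (Fin n) C).submatrix b a).det ∈ I := by
    intro b a
    by_cases hb : Function.Injective b
    · obtain ⟨π, hπ⟩ := exists_perm_strictMono hb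
      have h2 := h _ a hπ
      have h3 : (N : Matrix (Fin n) (Fin n) C).submatrix (b ∘ π) a =
        ((N : Matrix (Fin n) (Fin n) C).submatrix b a).submatrix π id := rfl
      rw [h3, Matrix.det_permute] at h2
      have h4 := I.mul_mem_left ((Equiv.Perm.sign π : ℤ) : C) h2
      rwa [← mul_assoc, ← Int.cast_mul, ← Units.val_mul, Int.units_mul_self, Units.val_one,
        Int.cast_one, one_mul] at h4
    · simp only [Function.Injective, not_forall] at hb
      obtain ⟨x, y, hxy, hne⟩ := hb
      rw [Matrix.det_zero_of_row_eq hne]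
      · exact I.zero_mem
      · ext l
        simp [hxy]
  have h2 := submatrix_det_mem_of_le _ I hj h1 id id
  rw [Matrix.submatrix_id_id] at h2
  exact I.eq_top_of_isUnit_mem h2 ((Matrix.isUnit_iff_isUnit_det _).mp N.isUnit)

theorem mem_span_of_forall_functional {k : Type} [Field k] {B : Type} [CommRing B] [Algebra k B]
    {V : Type} [AddCommGroup V] [Module k V] (V' : Submodule k V) (x : B ⊗[k] V)
    (h : ∀ ℓ : B →ₗ[k] k, TensorProduct.lid k V (ℓ.rTensor V x) ∈ V') :
    x ∈ Submodule.span B (⇑(TensorProduct.mk k B V 1) '' (V' : Set V)) := by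
  let ℬ := Module.Basis.ofVectorSpace k B
  have hx : x = ∑ i ∈ (TensorProduct.equivFinsuppOfBasisLeft ℬ x).support,
      ℬ i ⊗ₜ[k] (TensorProduct.equivFinsuppOfBasisLeft ℬ x) i := by
    conv_lhs => rw [← (TensorProduct.equivFinsuppOfBasisLeft ℬ).symm_apply_apply x,
      TensorProduct.equivFinsuppOfBasisLeft_symm_apply]
    rfl
  rw [hx]
  refine Submodule.sum_mem _ fun i _ => ?_
  have h1 : (TensorProduct.equivFinsuppOfBasisLeft ℬ x) i =
      TensorProduct.lid k V ((ℬ.coord i).rTensor V x) := by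
    rw [TensorProduct.equivFinsuppOfBasisLeft_apply]
  have h2 : ℬ i ⊗ₜ[k] (TensorProduct.equivFinsuppOfBasisLeft ℬ x) i =
      ℬ i • ((1 : B) ⊗ₜ[k] (TensorProduct.equivFinsuppOfBasisLeft ℬ x) i) := by
    rw [TensorProduct.smul_tmul', smul_eq_mul, mul_one]
  rw [h2]
  refine Submodule.smul_mem _ _ (Submodule.subset_span ⟨_, ?_, rfl⟩)
  rw [h1]
  exact h _

section Action

variable {k : Type} [Field k] {p n r i : ℕ} {V : Type} [AddCommGroup V] [Module k V]

/-- The action of automorphisms on decomposable tensors, in terms of the columns of the Jacobian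
matrix and of its entrywise Frobenius. -/
def ActionFormula (k : Type) [Field k] (p n q i : ℕ) (V : Type) [AddCommGroup V] [Module k V]
    (σ : ∀ (B : Type) [CommRing B] [Algebra k B],
      GL (Fin n) B →* ((B ⊗[k] V) ≃ₗ[B] (B ⊗[k] V)))
    (ρI : ∀ (B : Type) [CommRing B] [Algebra k B],
      (Rq B n q ≃ₐ[B] Rq B n q) →*
        ((Rq B n q ⊗[k] ((↥(⋀[k]^i (Fin n → k))) ⊗[k] V)) ≃ₗ[B]
          (Rq B n q ⊗[k] ((↥(⋀[k]^i (Fin n → k))) ⊗[k] V)))) : Prop :=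
  ∀ (B : Type) [CommRing B] [Algebra k B] (g : Rq B n q ≃ₐ[B] Rq B n q)
    (Pg : Fin n → MvPolynomial (Fin n) B),
    (∀ j, Ideal.Quotient.mk (truncIdeal B n q) (Pg j) =
      g (Ideal.Quotient.mk (truncIdeal B n q) (X j))) →
    ∀ J J' : GL (Fin n) (Rq B n q),
      (∀ a b, (J : Matrix (Fin n) (Fin n) (Rq B n q)) a b =
        Ideal.Quotient.mk (truncIdeal B n q) (pderiv a (Pg b))) →
      (∀ a b, (J' : Matrix (Fin n) (Fin n) (Rq B n q)) a b =
        ((J : Matrix (Fin n) (Fin n) (Rq B n q)) a b) ^ p) →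
      ∀ (f : Rq B n q) (a : Fin i → Fin n) (v : V),
        ρI B g (f ⊗ₜ[k] wedgeTensor k n i V a v) =
          g f • wedgeMap (Rq B n q) (σ (Rq B n q) J' (1 ⊗ₜ[k] v))
            (fun m j => (J : Matrix (Fin n) (Fin n) (Rq B n q)) j (a m))

theorem actionFormula_of_minors {q : ℕ}
    (σ : ∀ (B : Type) [CommRing B] [Algebra k B],
      GL (Fin n) B →* ((B ⊗[k] V) ≃ₗ[B] (B ⊗[k] V)))
    (ρT : ∀ (C : Type) [CommRing C] [Algebra k C],
      GL (Fin n) C →*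
        ((C ⊗[k] ((↥(⋀[k]^i (Fin n → k))) ⊗[k] V)) ≃ₗ[C]
          (C ⊗[k] ((↥(⋀[k]^i (Fin n → k))) ⊗[k] V))))
    (hT : ∀ (C : Type) [CommRing C] [Algebra k C],
      ∀ M M' : GL (Fin n) C,
        (∀ a b, (M' : Matrix (Fin n) (Fin n) C) a b = ((M : Matrix (Fin n) (Fin n) C) a b) ^ p) →
        ∀ (a : Fin i → Fin n) (v : V),
          ρT C M ((1 : C) ⊗ₜ[k]
              (wedgeGen k n i (fun l => Pi.single (a l) 1) ⊗ₜ[k] v)) =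
            ∑ b ∈ Finset.univ.filter (fun b : Fin i → Fin n => StrictMono b),
              (((M : Matrix (Fin n) (Fin n) C).submatrix b a).det) •
                TensorProduct.map LinearMap.id
                  (TensorProduct.mk k (↥(⋀[k]^i (Fin n → k))) V
                    (wedgeGen k n i (fun l => Pi.single (b l) 1)))
                  (σ C M' ((1 : C) ⊗ₜ[k] v)))
    (ρI : ∀ (B : Type) [CommRing B] [Algebra k B],
      (Rq B n q ≃ₐ[B] Rq B n q) →*
        ((Rq B n q ⊗[k] ((↥(⋀[k]^i (Fin n → k))) ⊗[k] V)) ≃ₗ[B]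
          (Rq B n q ⊗[k] ((↥(⋀[k]^i (Fin n → k))) ⊗[k] V))))
    (hform : ∀ (B : Type) [CommRing B] [Algebra k B],
      ∀ (g : Rq B n q ≃ₐ[B] Rq B n q) (Pg : Fin n → MvPolynomial (Fin n) B),
        (∀ j, Ideal.Quotient.mk _ (Pg j) = g (Ideal.Quotient.mk _ (X j))) →
        ∀ J : GL (Fin n) (Rq B n q),
          (∀ a b, (J : Matrix (Fin n) (Fin n) (Rq B n q)) a b =
            Ideal.Quotient.mk _ (pderiv a (Pg b))) →
          ∀ (P : MvPolynomial (Fin n) B) (w : (↥(⋀[k]^i (Fin n → k))) ⊗[k] V),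
            ρI B g (Ideal.Quotient.mk _ P ⊗ₜ[k] w) =
              ρT (Rq B n q) J (g (Ideal.Quotient.mk _ P) ⊗ₜ[k] w)) :
    ActionFormula k p n q i V σ ρI := by
  intro B _ _ g Pg hPg J J' hJ hJ' f a v
  obtain ⟨P, rfl⟩ := Ideal.Quotient.mk_surjective f
  rw [hform B g Pg hPg J hJ]
  have h1 : g (Ideal.Quotient.mk (truncIdeal B n q) P) ⊗ₜ[k] wedgeTensor k n i V a v =
      g (Ideal.Quotient.mk (truncIdeal B n q) P) •
        ((1 : Rq B n q) ⊗ₜ[k] wedgeTensor k n i V a v) := by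
    rw [TensorProduct.smul_tmul', smul_eq_mul, mul_one]
  rw [h1, map_smul, wedgeTensor_apply, hT _ J J' hJ', wedgeMap_apply]
  congr 1
  refine Finset.sum_congr rfl fun b _ => ?_
  rw [← Matrix.det_transpose]
  rfl

variable {q : ℕ} {σ : ∀ (B : Type) [CommRing B] [Algebra k B],
      GL (Fin n) B →* ((B ⊗[k] V) ≃ₗ[B] (B ⊗[k] V))}
    {ρI : ∀ (B : Type) [CommRing B] [Algebra k B],
      (Rq B n q ≃ₐ[B] Rq B n q) →*
        ((Rq B n q ⊗[k] ((↥(⋀[k]^i (Fin n → k))) ⊗[k] V)) ≃ₗ[B]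
          (Rq B n q ⊗[k] ((↥(⋀[k]^i (Fin n → k))) ⊗[k] V)))}
    {W : Submodule k ((Rq k n q) ⊗[k] ((↥(⋀[k]^i (Fin n → k))) ⊗[k] V))}

/-- The `ℓ`-component of the restriction to `R(n,r) ⊗ T` of an endomorphism of
`R(n,r)_B ⊗ T`. -/
noncomputable def componentMap {B : Type} [CommRing B] [Algebra k B] {T : Type} [AddCommMonoid T]
    [Module k T] (ψ : (Rq B n q ⊗[k] T) ≃ₗ[B] (Rq B n q ⊗[k] T)) (ℓ : B →ₗ[k] k) :
    (Rq k n q ⊗[k] T) →ₗ[k] (Rq k n q ⊗[k] T) :=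
  (coefMap n q ℓ).rTensor T ∘ₗ (ψ.toLinearMap.restrictScalars k) ∘ₗ
    (baseHom k n q B).toLinearMap.rTensor T

theorem componentMap_tmul {B : Type} [CommRing B] [Algebra k B] {T : Type} [AddCommMonoid T]
    [Module k T] (ψ : (Rq B n q ⊗[k] T) ≃ₗ[B] (Rq B n q ⊗[k] T)) (ℓ : B →ₗ[k] k)
    (P : MvPolynomial (Fin n) k) (t : T) :
    componentMap ψ ℓ (Ideal.Quotient.mk (truncIdeal k n q) P ⊗ₜ[k] t) =
      (coefMap n q ℓ).rTensor T (ψ (Ideal.Quotient.mk (truncIdeal B n q)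
        (MvPolynomial.map (algebraMap k B) P) ⊗ₜ[k] t)) := by
  rw [componentMap, LinearMap.comp_apply, LinearMap.comp_apply, LinearMap.rTensor_tmul,
    AlgHom.toLinearMap_apply, baseHom_mk]
  rfl

theorem InvPred.componentMap_mem (hW : InvPred k n q i V ρI W) {B : Type} [CommRing B]
    [Algebra k B] (g : Rq B n q ≃ₐ[B] Rq B n q) (ℓ : B →ₗ[k] k)
    {w : (Rq k n q) ⊗[k] ((↥(⋀[k]^i (Fin n → k))) ⊗[k] V)} (hw : w ∈ W) :
    componentMap (ρI B g) ℓ w ∈ W := by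
  apply coefMap_rTensor_mem ℓ W
  apply hW B ((baseHom k n q B).toLinearMap.rTensor _)
  · intro P w
    rw [LinearMap.rTensor_tmul, AlgHom.toLinearMap_apply, baseHom_mk]
  · exact Submodule.subset_span ⟨w, hw, rfl⟩

theorem ActionFormula.apply_of_unipotent_translation (hA : ActionFormula k p n q i V σ ρI)
    {B : Type} [CommRing B] [Algebra k B] (g : Rq B n q ≃ₐ[B] Rq B n q) (β : Fin n → B)
    (hg : ∀ j, Ideal.Quotient.mk (truncIdeal B n q) (X j + C (β j)) =
      g (Ideal.Quotient.mk (truncIdeal B n q) (X j))) (hp : p ≠ 0)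
    (f : Rq B n q) (t : (↥(⋀[k]^i (Fin n → k))) ⊗[k] V) :
    ρI B g (f ⊗ₜ[k] t) = g f ⊗ₜ[k] t := by
  induction span_wedgeTensor t using Submodule.span_induction with
  | mem x h =>
    obtain ⟨a, v, _, rfl⟩ := h
    rw [hA B g _ hg 1 1]
    · rw [map_one, LinearEquiv.coe_one, id]
      have : (fun (m : Fin i) j => ((1 : GL (Fin n) (Rq B n q)) :
          Matrix (Fin n) (Fin n) (Rq B n q)) j (a m)) =
          fun m => Pi.single (a m) 1 := by
        ext m j
        simp [Matrix.one_apply, Pi.single_apply]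
      rw [this, wedgeMap_single, LinearMap.baseChange_tmul, TensorProduct.smul_tmul', smul_eq_mul,
        mul_one]
    · intro a b
      rcases eq_or_ne a b with rfl | h
      · simp
      · simp [h, h.symm]
    · intro a b
      rcases eq_or_ne a b with rfl | h
      · simp
      · simp [h, hp]
  | zero => simp
  | add x y _ _ hx hy => rw [TensorProduct.tmul_add, map_add, hx, hy, TensorProduct.tmul_add]
  | smul c x _ hx =>
    rw [← TensorProduct.smul_tmul, ← algebraMap_smul B c f, ← TensorProduct.smul_tmul', map_smul,
      hx, TensorProduct.smul_tmul', algebraMap_smul, TensorProduct.smul_tmul]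

end Action

section Constants

variable {k : Type} [Field k] {n q : ℕ}

/-- The coefficient of a monomial `x^β` with all exponents less than `q`, as a functional on the
truncated polynomial ring. -/
noncomputable def truncCoeff {β : Fin n →₀ ℕ} (hβ : ∀ i, β i < q) : Rq k n q →ₗ[k] k :=
  Submodule.liftQ ((truncIdeal k n q).restrictScalars k) (lcoeff k β) (by
    intro P hP
    rw [LinearMap.mem_ker, lcoeff_apply]
    rw [Submodule.restrictScalars_mem] at hP
    suffices h : ∀ Q : MvPolynomial (Fin n) k, coeff β (Q * P) = 0 by simpa using h 1
    refine Submodule.span_induction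
      (p := fun P _ => ∀ Q : MvPolynomial (Fin n) k, coeff β (Q * P) = 0) ?_ ?_ ?_ ?_ hP
    · rintro _ ⟨i, rfl⟩ Q
      change coeff β (Q * X i ^ q) = 0
      rw [X_pow_eq_monomial, coeff_mul_monomial', if_neg]
      intro h
      have := h i
      rw [Finsupp.single_eq_same] at this
      exact absurd (hβ i) (not_lt.mpr this)
    · intro Q; simp
    · intro x y _ _ hx hy Q
      rw [mul_add, coeff_add, hx, hy, add_zero]
    · intro a x _ hx Q
      rw [smul_eq_mul, ← mul_assoc]; exact hx _)

theorem truncCoeff_mk {β : Fin n →₀ ℕ} (hβ : ∀ i, β i < q) (P : MvPolynomial (Fin n) k) :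
    truncCoeff hβ (Ideal.Quotient.mk (truncIdeal k n q) P) = coeff β P := rfl

/-- Polynomials over `R(n,r)` whose coefficients have degree less than `m`. -/
noncomputable def lowDegree (k : Type) [Field k] (n q m : ℕ) :
    Submodule k (MvPolynomial (Fin n) (Rq k n q)) :=
  Submodule.span k {x | ∃ (γ : Fin n →₀ ℕ) (P : MvPolynomial (Fin n) k), γ.degree < m ∧
    x = (Ideal.Quotient.mk (truncIdeal k n q) (monomial γ 1)) •
      MvPolynomial.map (algebraMap k (Rq k n q)) P}

theorem lowDegree_mono {m m' : ℕ} (h : m ≤ m') : lowDegree k n q m ≤ lowDegree k n q m' :=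
  Submodule.span_mono fun _ ⟨γ, P, hγ, hx⟩ => ⟨γ, P, hγ.trans_le h, hx⟩

theorem lowDegree_mul_X {m : ℕ} (j : Fin n) {x : MvPolynomial (Fin n) (Rq k n q)}
    (hx : x ∈ lowDegree k n q m) : x * X j ∈ lowDegree k n q m := by
  induction hx using Submodule.span_induction with
  | mem x h =>
    obtain ⟨γ, P, hγ, rfl⟩ := h
    exact Submodule.subset_span ⟨γ, P * X j, hγ, by rw [map_mul, map_X, smul_mul_assoc]⟩
  | zero => rw [zero_mul]; exact zero_mem _
  | add x y _ _ hx hy => rw [add_mul]; exact add_mem hx hy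
  | smul c x _ hx => rw [smul_mul_assoc]; exact Submodule.smul_mem _ _ hx

theorem lowDegree_mul_C {m : ℕ} (j : Fin n) {x : MvPolynomial (Fin n) (Rq k n q)}
    (hx : x ∈ lowDegree k n q m) :
    x * C (Ideal.Quotient.mk (truncIdeal k n q) (X j)) ∈ lowDegree k n q (m + 1) := by
  induction hx using Submodule.span_induction with
  | mem x h =>
    obtain ⟨γ, P, hγ, rfl⟩ := h
    refine Submodule.subset_span ⟨γ + Finsupp.single j 1, P, ?_, ?_⟩
    · rw [map_add, Finsupp.degree_single]; lia
    · rw [monomial_add_single, pow_one, map_mul, smul_eq_C_mul, smul_eq_C_mul, C_mul]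
      ring
  | zero => rw [zero_mul]; exact zero_mem _
  | add x y _ _ hx hy => rw [add_mul]; exact add_mem hx hy
  | smul c x _ hx => rw [smul_mul_assoc]; exact Submodule.smul_mem _ _ hx

theorem translate_monomial_sub_mem (α : Fin n →₀ ℕ) :
    aeval (fun j => X j + C (Ideal.Quotient.mk (truncIdeal k n q) (X j)))
        (monomial α (1 : Rq k n q)) -
      C (Ideal.Quotient.mk (truncIdeal k n q) (monomial α 1)) ∈ lowDegree k n q α.degree := by
  induction hm : α.degree generalizing α with
  | zero =>
    obtain rfl : α = 0 := (Finsupp.degree_eq_zero_iff α).mp hm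
    have : monomial (0 : Fin n →₀ ℕ) (1 : Rq k n q) = 1 := rfl
    have h2 : monomial (0 : Fin n →₀ ℕ) (1 : k) = 1 := rfl
    rw [this, h2]
    simp
  | succ m ih =>
    have hα : α ≠ 0 := by rintro rfl; simp at hm
    obtain ⟨j, hj⟩ := Finsupp.ne_iff.mp hα
    have hα' := Finsupp.sub_add_single_one_cancel (u := α) (i := j) hj
    set α' := α - Finsupp.single j 1
    have hdeg : α'.degree = m := by
      have := congrArg Finsupp.degree hα'
      rw [map_add, Finsupp.degree_single, hm] at this
      lia
    have ih := ih α' hdeg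
    rw [← hα', monomial_add_single, monomial_add_single, pow_one, pow_one, map_mul, map_mul,
      aeval_X, C_mul]
    set f := aeval (fun j => X j + C (Ideal.Quotient.mk (truncIdeal k n q) (X j)))
        (monomial α' (1 : Rq k n q))
    set c : MvPolynomial (Fin n) (Rq k n q) :=
      C (Ideal.Quotient.mk (truncIdeal k n q) (monomial α' 1)) with hc
    set a := C (σ := Fin n) (Ideal.Quotient.mk (truncIdeal k n q) (X j)) with ha
    have : f * (X j + a) - c * a = (f - c) * X j + (f - c) * a + c * X j := by ring
    rw [this]
    refine add_mem (add_mem (lowDegree_mono (Nat.le_succ m) (lowDegree_mul_X j ih))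
      (lowDegree_mul_C j ih)) (Submodule.subset_span ⟨α', X j, by lia, ?_⟩)
    rw [map_X, hc, smul_eq_C_mul]

theorem coefPoly_translate_monomial {α β : Fin n →₀ ℕ} (hβ : ∀ i, β i < q)
    (h : α.degree ≤ β.degree) :
    coefPoly n (truncCoeff hβ)
      (aeval (fun j => X j + C (Ideal.Quotient.mk (truncIdeal k n q) (X j)))
        (monomial α (1 : Rq k n q))) = if α = β then 1 else 0 := by
  have hlow : ∀ x ∈ lowDegree k n q β.degree, coefPoly n (truncCoeff hβ) x = 0 := by
    intro x hx
    induction hx using Submodule.span_induction with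
    | mem x h =>
      obtain ⟨γ, P, hγ, rfl⟩ := h
      rw [coefPoly_smul_map, truncCoeff_mk, coeff_monomial, if_neg, zero_smul]
      rintro rfl; exact lt_irrefl _ hγ
    | zero => rw [map_zero]
    | add x y _ _ hx hy => rw [map_add, hx, hy, add_zero]
    | smul c x _ hx => rw [map_smul, hx, smul_zero]
  have h1 := hlow _ (lowDegree_mono h (translate_monomial_sub_mem (k := k) (q := q) α))
  rw [map_sub, sub_eq_zero] at h1
  rw [h1]
  have := coefPoly_smul_map (n := n) (truncCoeff hβ)
    (Ideal.Quotient.mk (truncIdeal k n q) (monomial α 1)) 1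
  rw [(MvPolynomial.map (algebraMap k (Rq k n q))).map_one, smul_eq_C_mul, mul_one,
    truncCoeff_mk, coeff_monomial] at this
  rw [this]
  split_ifs <;> simp

theorem exists_monomial_expansion {T : Type} [AddCommMonoid T] [Module k T]
    (w : Rq k n q ⊗[k] T) :
    ∃ t : (Fin n →₀ ℕ) →₀ T, (∀ α ∈ t.support, ∀ i, α i < q) ∧
      w = t.sum fun α x => Ideal.Quotient.mk (truncIdeal k n q) (monomial α 1) ⊗ₜ[k] x := by
  have hadd : ∀ x y : Rq k n q ⊗[k] T,
      (∃ t : (Fin n →₀ ℕ) →₀ T, (∀ α ∈ t.support, ∀ i, α i < q) ∧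
        x = t.sum fun α x => Ideal.Quotient.mk (truncIdeal k n q) (monomial α 1) ⊗ₜ[k] x) →
      (∃ t : (Fin n →₀ ℕ) →₀ T, (∀ α ∈ t.support, ∀ i, α i < q) ∧
        y = t.sum fun α x => Ideal.Quotient.mk (truncIdeal k n q) (monomial α 1) ⊗ₜ[k] x) →
      ∃ t : (Fin n →₀ ℕ) →₀ T, (∀ α ∈ t.support, ∀ i, α i < q) ∧
        x + y = t.sum fun α x =>
          Ideal.Quotient.mk (truncIdeal k n q) (monomial α 1) ⊗ₜ[k] x := by
    rintro x y ⟨t, ht, rfl⟩ ⟨u, hu, rfl⟩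
    refine ⟨t + u, fun α hα => ?_, ?_⟩
    · rcases Finset.mem_union.mp (Finsupp.support_add hα) with h | h
      · exact ht α h
      · exact hu α h
    · rw [Finsupp.sum_add_index']
      · intro α; exact TensorProduct.tmul_zero _ _
      · intro α x y; exact TensorProduct.tmul_add _ _ _
  induction w using TensorProduct.induction_on with
  | zero => exact ⟨0, by simp, by simp⟩
  | add x y hx hy => exact hadd x y hx hy
  | tmul f x =>
    obtain ⟨P, rfl⟩ := Ideal.Quotient.mk_surjective f
    induction P using MvPolynomial.induction_on' with
    | add P Q hP hQ => rw [map_add, TensorProduct.add_tmul]; exact hadd _ _ hP hQ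
    | monomial α c =>
      by_cases hα : ∀ i, α i < q
      · refine ⟨Finsupp.single α (c • x), fun β hβ => ?_, ?_⟩
        · have := Finset.mem_singleton.mp (Finsupp.support_single_subset hβ)
          subst this; exact hα
        · rw [Finsupp.sum_single_index (by rw [TensorProduct.tmul_zero]), ← TensorProduct.smul_tmul]
          congr 1
          have : monomial α c = c • monomial α (1 : k) := by rw [smul_monomial, smul_eq_mul, mul_one]
          rw [this]; rfl
      · refine ⟨0, by simp, ?_⟩
        push Not at hα
        obtain ⟨i, hi⟩ := hα
        have : Ideal.Quotient.mk (truncIdeal k n q) (monomial α c) = 0 := by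
          rw [Ideal.Quotient.eq_zero_iff_mem]
          have h : monomial α c = monomial (α - Finsupp.single i q) c * X i ^ q := by
            rw [X_pow_eq_monomial, monomial_mul, mul_one, tsub_add_cancel_of_le]
            intro j
            rcases eq_or_ne i j with rfl | hij
            · rwa [Finsupp.single_eq_same]
            · rw [Finsupp.single_eq_of_ne hij.symm]; exact Nat.zero_le _
          rw [h]
          exact Ideal.mul_mem_left _ _ (Ideal.subset_span ⟨i, rfl⟩)
        rw [this, TensorProduct.zero_tmul]; simp

variable {p r i : ℕ} {V : Type} [AddCommGroup V] [Module k V]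
    {σ : ∀ (B : Type) [CommRing B] [Algebra k B],
      GL (Fin n) B →* ((B ⊗[k] V) ≃ₗ[B] (B ⊗[k] V))}
    {ρI : ∀ (B : Type) [CommRing B] [Algebra k B],
      (Rq B n (p ^ r) ≃ₐ[B] Rq B n (p ^ r)) →*
        ((Rq B n (p ^ r) ⊗[k] ((↥(⋀[k]^i (Fin n → k))) ⊗[k] V)) ≃ₗ[B]
          (Rq B n (p ^ r) ⊗[k] ((↥(⋀[k]^i (Fin n → k))) ⊗[k] V)))}
    {W : Submodule k ((Rq k n (p ^ r)) ⊗[k] ((↥(⋀[k]^i (Fin n → k))) ⊗[k] V))}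

theorem exists_translation [Fact p.Prime] [CharP k p] {B : Type} [CommRing B] [Algebra k B]
    (β : Fin n → B) (hβ : ∀ j, β j ^ p ^ r = 0) :
    ∃ g : Rq B n (p ^ r) ≃ₐ[B] Rq B n (p ^ r), ∀ j,
      Ideal.Quotient.mk (truncIdeal B n (p ^ r)) (X j + C (β j)) =
      g (Ideal.Quotient.mk (truncIdeal B n (p ^ r)) (X j)) := by
  have h0 : ∀ γ : B, γ ^ p ^ r = 0 → ∀ j : Fin n,
      (Ideal.Quotient.mk (truncIdeal B n (p ^ r)) (X j + C γ)) ^ p ^ r = 0 := by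
    intro γ hγ j
    rw [map_add, add_pow_char_pow_of_algebra k p, mk_X_pow, ← map_pow, ← map_pow, hγ, map_zero,
      map_zero, add_zero]
  refine exists_truncAut (fun j => X j + C (β j)) (fun j => X j + C (-β j))
    (fun j => h0 _ (hβ j) j) (fun j => h0 _ ?_ j) (fun j => ?_) (fun j => ?_)
  · rw [neg_pow, hβ j, mul_zero]
  · simp
  · simp

theorem exists_constant_mem [Fact p.Prime] [CharP k p]
    (hA : ActionFormula k p n (p ^ r) i V σ ρI)
    (hW : InvPred k n (p ^ r) i V ρI W) (hW0 : W ≠ ⊥) :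
    ∃ t : (↥(⋀[k]^i (Fin n → k))) ⊗[k] V, t ≠ 0 ∧ (1 : Rq k n (p ^ r)) ⊗ₜ[k] t ∈ W := by
  obtain ⟨w, hw, hw0⟩ := W.exists_mem_ne_zero_of_ne_bot hW0
  obtain ⟨t, ht, hwt⟩ := exists_monomial_expansion w
  have ht0 : t ≠ 0 := by
    rintro rfl
    exact hw0 (by simpa using hwt)
  obtain ⟨β, hβ, hmax⟩ := t.support.exists_max_image Finsupp.degree
    (Finsupp.support_nonempty_iff.mpr ht0)
  refine ⟨t β, Finsupp.mem_support_iff.mp hβ, ?_⟩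
  obtain ⟨g, hg⟩ := exists_translation (k := k) (p := p) (r := r)
    (fun j : Fin n => Ideal.Quotient.mk (truncIdeal k n (p ^ r)) (X j)) (mk_X_pow n _)
  have hcomp : ∀ α : Fin n →₀ ℕ, ∀ x : (↥(⋀[k]^i (Fin n → k))) ⊗[k] V, α.degree ≤ β.degree →
      componentMap (ρI _ g) (truncCoeff (ht β hβ))
        (Ideal.Quotient.mk (truncIdeal k n (p ^ r)) (monomial α 1) ⊗ₜ[k] x) =
      Ideal.Quotient.mk (truncIdeal k n (p ^ r)) (if α = β then 1 else 0) ⊗ₜ[k] x := by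
    intro α x hα
    rw [componentMap_tmul, hA.apply_of_unipotent_translation g _ hg (Fact.out : p.Prime).ne_zero,
      LinearMap.rTensor_tmul, map_monomial, map_one]
    have h2 := mk_aeval_eq g.toAlgHom _ hg (monomial α 1)
    change _ = g _ at h2
    rw [← h2, coefMap_mk, coefPoly_translate_monomial _ hα]
  have h1 := hW.componentMap_mem g (truncCoeff (ht β hβ)) hw
  have h3 : componentMap (ρI _ g) (truncCoeff (ht β hβ)) w = 1 ⊗ₜ[k] t β := by
    rw [hwt, Finsupp.sum, map_sum, Finset.sum_eq_single β]
    · rw [hcomp β _ le_rfl, if_pos rfl, map_one]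
    · intro α hα hαβ
      rw [hcomp α _ (hmax α hα), if_neg hαβ, map_zero, TensorProduct.zero_tmul]
    · intro h; exact absurd hβ h
  rwa [h3] at h1

end Constants

section Lie

variable {k : Type} [Field k] {p n r i : ℕ} {V : Type} [AddCommGroup V] [Module k V]

theorem wedgeMap_update_sum {C : Type} [CommRing C] [Algebra k C] (s : C ⊗[k] V)
    (a : Fin i → Fin n) (l : Fin i) (u : Fin n → C) :
    wedgeMap C s (Function.update (fun m => Pi.single (a m) 1) l u) =
      ∑ j, u j • (wedgeTensor k n i V (Function.update a l j)).baseChange C s := by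
  have hu : u = ∑ j, u j • (Pi.single j 1 : Fin n → C) := by
    ext j
    simp [Finset.sum_apply, Pi.single_apply]
  conv_lhs => rw [hu]
  rw [AlternatingMap.map_update_sum]
  refine Finset.sum_congr rfl fun j _ => ?_
  rw [AlternatingMap.map_update_smul, ← wedgeMap_single]
  congr 2
  ext m : 1
  rcases eq_or_ne m l with rfl | h
  · simp
  · simp [h]

theorem coefMap_rTensor_add_sum {q : ℕ} {T : Type} [AddCommMonoid T] [Module k T] {B : Type}
    [CommRing B] [Algebra k B] (ℓ : B →ₗ[k] k) (x : Rq B n q ⊗[k] T) (u : Fin n → Rq B n q)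
    (t : Fin n → T) :
    (coefMap n q ℓ).rTensor T (x + ∑ j, u j • (1 ⊗ₜ[k] t j)) =
      (coefMap n q ℓ).rTensor T x + ∑ j, coefMap n q ℓ (u j) ⊗ₜ[k] t j := by
  rw [map_add, map_sum]
  congr 1
  refine Finset.sum_congr rfl fun j _ => ?_
  rw [TensorProduct.smul_tmul', smul_eq_mul, mul_one, LinearMap.rTensor_tmul]

theorem baseChange_wedgeTensor {C : Type} [CommRing C] [Algebra k C] (a : Fin i → Fin n)
    (c : C) (v : V) :
    (wedgeTensor k n i V a).baseChange C (c ⊗ₜ[k] v) = c ⊗ₜ[k] wedgeTensor k n i V a v := rfl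

theorem wedgeMap_single_add_ite {C : Type} [CommRing C] [Algebra k C] (s : C ⊗[k] V)
    {a : Fin i → Fin n} (ha : Function.Injective a) {l : Fin i} {c : Fin n} (hl : a l = c)
    (u : Fin n → C) :
    wedgeMap C s (fun m => Pi.single (a m) 1 + if a m = c then u else 0) =
      (wedgeTensor k n i V a).baseChange C s +
        ∑ j, u j • (wedgeTensor k n i V (Function.update a l j)).baseChange C s := by
  have h1 : (fun m => Pi.single (a m) (1 : C) + if a m = c then u else 0) =
      Function.update (fun m => Pi.single (a m) (1 : C)) l (Pi.single (a l) 1 + u) := by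
    ext m : 1
    rcases eq_or_ne m l with rfl | h
    · rw [if_pos hl, Function.update_self]
    · rw [if_neg fun h' => h (ha (h'.trans hl.symm)), add_zero, Function.update_of_ne h]
  have h2 : Function.update (fun m => (Pi.single (a m) 1 : Fin n → C)) l (Pi.single (a l) 1) =
      fun m => Pi.single (a m) 1 :=
    Function.update_eq_self l fun m => (Pi.single (a m) (1 : C) : Fin n → C)
  rw [h1, AlternatingMap.map_update_add, h2, wedgeMap_single, wedgeMap_update_sum]

/-- The infinitesimal automorphism `x_c ↦ x_c + e F`. -/
noncomputable def infPoly {B : Type} [CommRing B] (e : B) (F : MvPolynomial (Fin n) B)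
    (c j : Fin n) : MvPolynomial (Fin n) B :=
  X j + if j = c then C e * F else 0

theorem C_mul_aeval_infPoly {B : Type} [CommRing B] {e e' : B} (h : e * e' = 0)
    (F : MvPolynomial (Fin n) B) (c : Fin n) (Q : MvPolynomial (Fin n) B) :
    C e * aeval (infPoly e' F c) Q = C e * Q := by
  induction Q using MvPolynomial.induction_on with
  | C a => rw [algHom_C, algebraMap_eq]
  | add P Q hP hQ => rw [map_add, mul_add, hP, hQ, mul_add]
  | mul_X P j hP =>
    rw [map_mul, aeval_X, ← mul_assoc, hP, ← mul_assoc, infPoly]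
    split_ifs with hj
    · have : C (σ := Fin n) e * C e' = 0 := by rw [← C_mul, h, C_0]
      linear_combination (P * F) * this
    · rw [add_zero]

theorem aeval_infPoly {B : Type} [CommRing B] {e e' : B} (h : e * e' = 0) (h' : e + e' = 0)
    (F : MvPolynomial (Fin n) B) (c j : Fin n) :
    aeval (infPoly e' F c) (infPoly e F c j) = X j := by
  rw [infPoly, map_add, aeval_X]
  split_ifs with hj
  · rw [map_mul, algHom_C, algebraMap_eq, C_mul_aeval_infPoly h, infPoly, if_pos hj]
    have : C (σ := Fin n) e + C e' = 0 := by rw [← C_add, h', C_0]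
    linear_combination F * this
  · rw [map_zero, add_zero, infPoly, if_neg hj, add_zero]

theorem exists_infAut [Fact p.Prime] [CharP k p] (hr : 1 ≤ r) {B : Type} [CommRing B]
    [Algebra k B] {e : B} (he : e * e = 0) (F : MvPolynomial (Fin n) B) (c : Fin n) :
    ∃ g : Rq B n (p ^ r) ≃ₐ[B] Rq B n (p ^ r), ∀ j,
      Ideal.Quotient.mk (truncIdeal B n (p ^ r)) (infPoly e F c j) =
      g (Ideal.Quotient.mk (truncIdeal B n (p ^ r)) (X j)) := by
  have hq : 2 ≤ p ^ r := (Fact.out : p.Prime).two_le.trans (Nat.le_self_pow (by lia) p)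
  have h0 : ∀ γ : B, γ * γ = 0 → ∀ j : Fin n,
      (Ideal.Quotient.mk (truncIdeal B n (p ^ r)) (infPoly γ F c j)) ^ p ^ r = 0 := by
    intro γ hγ j
    rw [infPoly, map_add, add_pow_char_pow_of_algebra k p, mk_X_pow, zero_add]
    split_ifs
    · rw [← map_pow, mul_pow, ← C_pow, pow_eq_zero_of_le hq (by rw [pow_two, hγ]), C_0, zero_mul,
        map_zero]
    · rw [map_zero, zero_pow (by lia)]
  exact exists_truncAut (infPoly e F c) (infPoly (-e) F c) (h0 e he)
    (h0 _ (by rw [neg_mul_neg, he])) (aeval_infPoly (by rw [neg_mul, he, neg_zero]) (by ring) F c)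
    (aeval_infPoly (by rw [mul_neg, he, neg_zero]) (by ring) F c)

variable {σ : ∀ (B : Type) [CommRing B] [Algebra k B],
      GL (Fin n) B →* ((B ⊗[k] V) ≃ₗ[B] (B ⊗[k] V))}
    {ρI : ∀ (B : Type) [CommRing B] [Algebra k B],
      (Rq B n (p ^ r) ≃ₐ[B] Rq B n (p ^ r)) →*
        ((Rq B n (p ^ r) ⊗[k] ((↥(⋀[k]^i (Fin n → k))) ⊗[k] V)) ≃ₗ[B]
          (Rq B n (p ^ r) ⊗[k] ((↥(⋀[k]^i (Fin n → k))) ⊗[k] V)))}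

theorem ActionFormula.apply_infAut [Fact p.Prime] [CharP k p] (hr : 1 ≤ r)
    (hA : ActionFormula k p n (p ^ r) i V σ ρI) {B : Type} [CommRing B] [Algebra k B]
    {e : B} (he : e * e = 0) (F : MvPolynomial (Fin n) B) (c : Fin n)
    (g : Rq B n (p ^ r) ≃ₐ[B] Rq B n (p ^ r)) (hg : ∀ j,
      Ideal.Quotient.mk (truncIdeal B n (p ^ r)) (infPoly e F c j) =
      g (Ideal.Quotient.mk (truncIdeal B n (p ^ r)) (X j))) (a : Fin i → Fin n) (v : V) :
    ρI B g (1 ⊗ₜ[k] wedgeTensor k n i V a v) =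
      wedgeMap (Rq B n (p ^ r)) (1 ⊗ₜ[k] v)
        (fun m => Pi.single (a m) 1 + if a m = c then
          fun j => Ideal.Quotient.mk (truncIdeal B n (p ^ r)) (C e * pderiv j F) else 0) := by
  have hq : ((p ^ r : ℕ) : B) = 0 := by
    rw [Nat.cast_pow, charP_cast_eq_zero_of_algebra k p B, zero_pow (by lia)]
  obtain ⟨J, hJ⟩ := exists_jacobian hq g _ hg
  have hJe : ∀ a b, (J : Matrix (Fin n) (Fin n) (Rq B n (p ^ r))) a b =
      (Pi.single b 1 : Fin n → Rq B n (p ^ r)) a +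
        (if b = c then fun j => Ideal.Quotient.mk (truncIdeal B n (p ^ r)) (C e * pderiv j F)
          else 0 : Fin n → Rq B n (p ^ r)) a := by
    intro a b
    rw [hJ, infPoly, map_add, pderiv_X, map_add]
    congr 1
    · rcases eq_or_ne a b with rfl | h
      · simp
      · simp [h, h.symm]
    · split_ifs with h
      · rw [Derivation.leibniz, pderiv_C, smul_zero, add_zero, smul_eq_mul]
      · rw [map_zero, map_zero]; rfl
  have hpow := add_pow_char_pow_of_algebra k p (A := Rq B n (p ^ r)) 1
  rw [pow_one] at hpow
  rw [hA B g _ hg J 1 hJ, map_one, map_one, LinearEquiv.coe_one, id, one_smul]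
  · congr 1
    ext m j
    exact hJe j (a m)
  · intro a b
    rw [hJe, hpow]
    have h2 : ((if b = c then
        fun j => Ideal.Quotient.mk (truncIdeal B n (p ^ r)) (C e * pderiv j F)
          else 0 : Fin n → Rq B n (p ^ r)) a) ^ p = 0 := by
      split_ifs
      · rw [← map_pow, mul_pow, ← C_pow,
          pow_eq_zero_of_le (Fact.out : p.Prime).two_le (by rw [pow_two, he]), C_0, zero_mul,
          map_zero]
      · exact zero_pow (Fact.out : p.Prime).ne_zero
    rw [h2, add_zero]
    rcases eq_or_ne a b with rfl | h
    · simp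
    · simp [h, (Fact.out : p.Prime).ne_zero]

theorem exists_lieOperator [Fact p.Prime] [CharP k p] (hr : 1 ≤ r)
    (hA : ActionFormula k p n (p ^ r) i V σ ρI) (F : MvPolynomial (Fin n) k) (c : Fin n) :
    ∃ L : ((↥(⋀[k]^i (Fin n → k))) ⊗[k] V) →ₗ[k]
        ((Rq k n (p ^ r)) ⊗[k] ((↥(⋀[k]^i (Fin n → k))) ⊗[k] V)),
      (∀ W, InvPred k n (p ^ r) i V ρI W → ∀ t, 1 ⊗ₜ[k] t ∈ W → L t ∈ W) ∧
      (∀ (a : Fin i → Fin n) (v : V), c ∉ Set.range a → L (wedgeTensor k n i V a v) = 0) ∧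
      ∀ (a : Fin i → Fin n) (v : V) (l : Fin i), Function.Injective a → a l = c →
        L (wedgeTensor k n i V a v) =
          ∑ j, Ideal.Quotient.mk (truncIdeal k n (p ^ r)) (pderiv j F) ⊗ₜ[k]
            wedgeTensor k n i V (Function.update a l j) v := by
  let F' := MvPolynomial.map (algebraMap k (DualNumber k)) F
  have he : (DualNumber.eps : DualNumber k) * DualNumber.eps = 0 := DualNumber.eps_mul_eps
  obtain ⟨g, hg⟩ := exists_infAut (k := k) (p := p) hr he F' c
  let ℓ : DualNumber k →ₗ[k] k := TrivSqZeroExt.sndHom k k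
  have hℓ1 : ℓ 1 = 0 := rfl
  have hℓe : ℓ DualNumber.eps = 1 := DualNumber.snd_eps
  have hone : ∀ t : (↥(⋀[k]^i (Fin n → k))) ⊗[k] V,
      (coefMap n (p ^ r) ℓ).rTensor _ ((1 : Rq (DualNumber k) n (p ^ r)) ⊗ₜ[k] t) = 0 := by
    intro t
    have := coefMap_smul_baseHom (n := n) (q := p ^ r) ℓ 1 1
    rw [one_smul, map_one, hℓ1, zero_smul] at this
    rw [LinearMap.rTensor_tmul, this, TensorProduct.zero_tmul]
  have hcomp : ∀ t : (↥(⋀[k]^i (Fin n → k))) ⊗[k] V,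
      componentMap (ρI _ g) ℓ (1 ⊗ₜ[k] t) =
        (coefMap n (p ^ r) ℓ).rTensor _ (ρI _ g (1 ⊗ₜ[k] t)) := by
    intro t
    have := componentMap_tmul (ρI _ g) ℓ 1 t
    rwa [map_one, map_one, map_one] at this
  refine ⟨componentMap (ρI _ g) ℓ ∘ₗ TensorProduct.mk k _ _ 1, fun W hW t ht =>
    hW.componentMap_mem g ℓ ht, fun a v hc => ?_, fun a v l ha hl => ?_⟩
  · rw [LinearMap.comp_apply, TensorProduct.mk_apply, hcomp, hA.apply_infAut hr he F' c g hg]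
    have : (fun m => Pi.single (a m) (1 : Rq (DualNumber k) n (p ^ r)) + if a m = c then
        fun j => Ideal.Quotient.mk (truncIdeal _ n (p ^ r))
          (C (DualNumber.eps : DualNumber k) * pderiv j F') else 0) =
        fun m => Pi.single (a m) 1 := by
      ext m : 1
      rw [if_neg fun h => hc ⟨m, h⟩, add_zero]
    rw [this, wedgeMap_single, LinearMap.baseChange_tmul, hone]
  · rw [LinearMap.comp_apply, TensorProduct.mk_apply, hcomp, hA.apply_infAut hr he F' c g hg]
    rw [wedgeMap_single_add_ite _ ha hl, baseChange_wedgeTensor]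
    simp only [baseChange_wedgeTensor]
    rw [coefMap_rTensor_add_sum, hone, zero_add]
    refine Finset.sum_congr rfl fun j _ => congrArg (· ⊗ₜ[k] _) ?_
    have h := coefMap_smul_baseHom (n := n) (q := p ^ r) ℓ DualNumber.eps
      (Ideal.Quotient.mk (truncIdeal k n (p ^ r)) (pderiv j F))
    rw [baseHom_mk, hℓe, one_smul] at h
    rw [← h]
    congr 1
    rw [pderiv_map, ← smul_eq_C_mul]
    rfl

end Lie

section Weights

theorem exists_perm_of_range_subset {n i : ℕ} {a b : Fin i → Fin n} (ha : Function.Injective a)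
    (h : ∀ l, a l ∈ Set.range b) : ∃ π : Equiv.Perm (Fin i), a = b ∘ π := by
  choose f hf using h
  have hinj : Function.Injective f := by
    intro x y hxy
    exact ha (by rw [← hf x, hxy, hf y])
  exact ⟨Equiv.ofBijective f (Finite.injective_iff_bijective.mp hinj), funext fun l => (hf l).symm⟩

variable {k : Type} [Field k] {p n r i : ℕ} {V : Type} [AddCommGroup V] [Module k V]

theorem exists_wedgeTensor_expansion (z : (↥(⋀[k]^i (Fin n → k))) ⊗[k] V) :
    ∃ v : (Fin i → Fin n) → V,
      z = ∑ b ∈ Finset.univ.filter (fun b : Fin i → Fin n => StrictMono b),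
        wedgeTensor k n i V b (v b) := by
  induction span_wedgeTensor z using Submodule.span_induction with
  | mem x h =>
    obtain ⟨a, v, ha, rfl⟩ := h
    refine ⟨fun b => if b = a then v else 0, ?_⟩
    rw [Finset.sum_eq_single a]
    · simp only [if_true]
    · intro b _ hb; simp only [if_neg hb, map_zero]
    · intro h; simp [ha] at h
  | zero => exact ⟨0, by simp⟩
  | add x y _ _ hx hy =>
    obtain ⟨v, rfl⟩ := hx
    obtain ⟨u, rfl⟩ := hy
    refine ⟨v + u, ?_⟩
    rw [← Finset.sum_add_distrib]
    exact Finset.sum_congr rfl fun b _ => (map_add _ _ _).symm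
  | smul c x _ hx =>
    obtain ⟨v, rfl⟩ := hx
    refine ⟨c • v, ?_⟩
    rw [Finset.smul_sum]
    exact Finset.sum_congr rfl fun b _ => (map_smul _ _ _).symm

variable {σ : ∀ (B : Type) [CommRing B] [Algebra k B],
      GL (Fin n) B →* ((B ⊗[k] V) ≃ₗ[B] (B ⊗[k] V))}
    {ρI : ∀ (B : Type) [CommRing B] [Algebra k B],
      (Rq B n (p ^ r) ≃ₐ[B] Rq B n (p ^ r)) →*
        ((Rq B n (p ^ r) ⊗[k] ((↥(⋀[k]^i (Fin n → k))) ⊗[k] V)) ≃ₗ[B]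
          (Rq B n (p ^ r) ⊗[k] ((↥(⋀[k]^i (Fin n → k))) ⊗[k] V)))}
    {W : Submodule k ((Rq k n (p ^ r)) ⊗[k] ((↥(⋀[k]^i (Fin n → k))) ⊗[k] V))}

/-- The constant vectors lying in a subspace of `R(n,r) ⊗ T`. -/
noncomputable def constants {q : ℕ} {T : Type} [AddCommMonoid T] [Module k T]
    (W : Submodule k ((Rq k n q) ⊗[k] T)) : Submodule k T :=
  W.comap (TensorProduct.mk k (Rq k n q) T 1)

theorem mem_constants {q : ℕ} {T : Type} [AddCommMonoid T] [Module k T]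
    {W : Submodule k ((Rq k n q) ⊗[k] T)} {t : T} : t ∈ constants W ↔ 1 ⊗ₜ[k] t ∈ W := Iff.rfl

theorem sum_mk_pderiv_X_tmul {q : ℕ} {T : Type} [AddCommMonoid T] [Module k T] (m : Fin n)
    (t : Fin n → T) :
    ∑ j, Ideal.Quotient.mk (truncIdeal k n q) (pderiv j (X m)) ⊗ₜ[k] t j =
      (1 : Rq k n q) ⊗ₜ[k] t m := by
  rw [Finset.sum_eq_single m]
  · rw [pderiv_X_self, map_one]
  · intro j _ hj
    rw [pderiv_X_of_ne hj.symm, map_zero, TensorProduct.zero_tmul]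
  · simp

theorem wedgeTensor_mem_of_sum_mem [Fact p.Prime] [CharP k p] (hr : 1 ≤ r)
    (hA : ActionFormula k p n (p ^ r) i V σ ρI) (hW : InvPred k n (p ^ r) i V ρI W)
    (v : (Fin i → Fin n) → V) (s : Finset (Fin i → Fin n)) (hs : ∀ a ∈ s, StrictMono a)
    (h : ∑ a ∈ s, wedgeTensor k n i V a (v a) ∈ constants W) {a : Fin i → Fin n} (ha : a ∈ s) :
    wedgeTensor k n i V a (v a) ∈ constants W := by
  induction s using Finset.strongInduction with
  | H s ih =>
    by_cases hsa : ∀ b ∈ s, b = a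
    · rw [Finset.sum_eq_single_of_mem a ha fun b hb hba => absurd (hsa b hb) hba] at h
      exact h
    · push Not at hsa
      obtain ⟨b, hb, hba⟩ := hsa
      obtain ⟨m, hm⟩ := exists_notMem_range_of_ne (hs a ha) (hs b hb) hba
      obtain ⟨L, hL, hL0, hL1⟩ := exists_lieOperator hr hA (X (a m)) (a m)
      refine ih (s.filter fun b => a m ∈ Set.range b) ?_ (fun b hb => hs b (Finset.mem_filter.mp hb).1)
        ?_ (Finset.mem_filter.mpr ⟨ha, ⟨m, rfl⟩⟩)
      · rw [Finset.filter_ssubset]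
        exact ⟨b, hb, hm⟩
      · have h1 := hL W hW _ h
        rw [mem_constants]
        convert h1 using 1
        rw [map_sum, Finset.sum_filter, TensorProduct.tmul_sum]
        refine Finset.sum_congr rfl fun b hb => ?_
        split_ifs with hbm
        · obtain ⟨l, hl⟩ := hbm
          rw [hL1 b (v b) l (hs b hb).injective hl,
            sum_mk_pderiv_X_tmul (a m) fun j => wedgeTensor k n i V (Function.update b l j) (v b),
            ← hl, Function.update_eq_self]
        · rw [hL0 b (v b) hbm, TensorProduct.tmul_zero]

theorem wedgeTensor_mem_of_injective [Fact p.Prime] [CharP k p] (hr : 1 ≤ r)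
    (hA : ActionFormula k p n (p ^ r) i V σ ρI) (hW : InvPred k n (p ^ r) i V ρI W)
    {v : V} {a : Fin i → Fin n} (ha : Function.Injective a)
    (h : wedgeTensor k n i V a v ∈ constants W) (b : Fin i → Fin n) :
    wedgeTensor k n i V b v ∈ constants W := by
  by_cases hb : Function.Injective b
  swap
  · rw [wedgeTensor_of_not_injective hb]; exact zero_mem _
  induction hN : (Finset.univ.filter fun l => a l ∉ Set.range b).card using Nat.strong_induction_on
    generalizing a with
  | _ N ih =>
    by_cases hab : ∀ l, a l ∈ Set.range b
    · obtain ⟨π, rfl⟩ := exists_perm_of_range_subset ha hab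
      rw [wedgeTensor_comp_perm, LinearMap.smul_apply] at h
      have := (constants W).smul_mem ((Equiv.Perm.sign π : ℤ) : k) h
      rwa [smul_smul, sign_cast_mul_self, one_smul] at this
    · push Not at hab
      obtain ⟨l, hl⟩ := hab
      have : ∃ m, b m ∉ Set.range a := by
        by_contra! hba
        obtain ⟨π, rfl⟩ := exists_perm_of_range_subset hb hba
        exact hl ⟨π.symm l, by simp⟩
      obtain ⟨m, hm⟩ := this
      obtain ⟨L, hL, -, hL1⟩ := exists_lieOperator hr hA (X (b m)) (a l)
      have h1 := hL W hW _ h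
      rw [hL1 a v l ha rfl,
        sum_mk_pderiv_X_tmul (b m) fun j => wedgeTensor k n i V (Function.update a l j) v] at h1
      refine ih _ ?_ (a := Function.update a l (b m)) ?_ h1 rfl
      · rw [← hN]
        refine Finset.card_lt_card (Finset.ssubset_iff_of_subset ?_ |>.mpr ⟨l, ?_, ?_⟩)
        · intro x hx
          rw [Finset.mem_filter] at hx ⊢
          refine ⟨Finset.mem_univ _, fun h => hx.2 ?_⟩
          rcases eq_or_ne x l with rfl | hxl
          · exact ⟨m, by simp⟩
          · rwa [Function.update_of_ne hxl]
        · exact Finset.mem_filter.mpr ⟨Finset.mem_univ _, hl⟩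
        · intro hx
          exact (Finset.mem_filter.mp hx).2 ⟨m, by simp⟩
      · intro x y hxy
        by_cases hx : x = l <;> by_cases hy : y = l
        · rw [hx, hy]
        · rw [hx, Function.update_self, Function.update_of_ne hy] at hxy
          exact absurd ⟨y, hxy.symm⟩ hm
        · rw [hy, Function.update_self, Function.update_of_ne hx] at hxy
          exact absurd ⟨x, hxy⟩ hm
        · rw [Function.update_of_ne hx, Function.update_of_ne hy] at hxy
          exact ha hxy

/-- The vectors `v` such that all `e_{a_1} ∧ ⋯ ∧ e_{a_i} ⊗ v` lie in `W`. -/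
noncomputable def wedgeVectors {q : ℕ}
    (W : Submodule k ((Rq k n q) ⊗[k] ((↥(⋀[k]^i (Fin n → k))) ⊗[k] V))) : Submodule k V :=
  ⨅ a : Fin i → Fin n, (constants W).comap (wedgeTensor k n i V a)

theorem mem_wedgeVectors {q : ℕ}
    {W : Submodule k ((Rq k n q) ⊗[k] ((↥(⋀[k]^i (Fin n → k))) ⊗[k] V))} {v : V} :
    v ∈ wedgeVectors W ↔ ∀ a, wedgeTensor k n i V a v ∈ constants W := by
  rw [wedgeVectors, Submodule.mem_iInf]; rfl

theorem wedgeVectors_ne_bot [Fact p.Prime] [CharP k p] (hr : 1 ≤ r)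
    (hA : ActionFormula k p n (p ^ r) i V σ ρI) (hW : InvPred k n (p ^ r) i V ρI W)
    (hW0 : W ≠ ⊥) : wedgeVectors W ≠ ⊥ := by
  obtain ⟨t, ht0, ht⟩ := exists_constant_mem hA hW hW0
  obtain ⟨v, hv⟩ := exists_wedgeTensor_expansion t
  rw [hv] at ht0
  obtain ⟨a, ha, ha0⟩ := Finset.exists_ne_zero_of_sum_ne_zero ht0
  have hmem := wedgeTensor_mem_of_sum_mem hr hA hW v _
    (fun a ha => (Finset.mem_filter.mp ha).2) (by rw [← hv]; exact ht) ha
  rw [Submodule.ne_bot_iff]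
  refine ⟨v a, mem_wedgeVectors.mpr (wedgeTensor_mem_of_injective hr hA hW
    (Finset.mem_filter.mp ha).2.injective hmem), fun h => ha0 ?_⟩
  rw [h, map_zero]

end Weights

section LinearPart

variable {k : Type} [Field k] {p n r i : ℕ} {V : Type} [AddCommGroup V] [Module k V]

/-- The linear polynomials given by the columns of a matrix. -/
noncomputable def linPoly {C : Type} [CommRing C] (N : Matrix (Fin n) (Fin n) C) (b : Fin n) :
    MvPolynomial (Fin n) C :=
  ∑ a, MvPolynomial.C (N a b) * X a

theorem aeval_linPoly {C : Type} [CommRing C] {N N' : Matrix (Fin n) (Fin n) C}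
    (h : N * N' = 1) (b : Fin n) : aeval (linPoly N) (linPoly N' b) = X b := by
  have h1 : aeval (linPoly N) (linPoly N' b) = linPoly (N * N') b := by
    simp only [linPoly, map_sum, map_mul, aeval_X, algHom_C, algebraMap_eq, Matrix.mul_apply,
      Finset.mul_sum, Finset.sum_mul]
    rw [Finset.sum_comm]
    refine Finset.sum_congr rfl fun c _ => Finset.sum_congr rfl fun a _ => ?_
    ring
  rw [h1, h, linPoly, Finset.sum_eq_single b]
  · simp
  · intro a _ hab; simp [hab]
  · simp

theorem mk_linPoly_pow (k : Type) [Field k] (p : ℕ) [Fact p.Prime] [CharP k p] {C : Type}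
    [CommRing C] [Algebra k C] (N : Matrix (Fin n) (Fin n) C) (j : Fin n) :
    (Ideal.Quotient.mk (truncIdeal C n (p ^ r)) (linPoly N j)) ^ p ^ r = 0 := by
  have h : ∀ a : Fin n, algFrobenius k p (Rq C n (p ^ r)) r
      (Ideal.Quotient.mk (truncIdeal C n (p ^ r)) (MvPolynomial.C (N a j) * X a)) = 0 := by
    intro a
    rw [algFrobenius_apply, map_mul, mul_pow, mk_X_pow, mul_zero]
  have h2 := map_sum ((algFrobenius k p (Rq C n (p ^ r)) r).comp
    (Ideal.Quotient.mk (truncIdeal C n (p ^ r))))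
    (fun a : Fin n => MvPolynomial.C (N a j) * X a) Finset.univ
  exact (h2.trans (Finset.sum_eq_zero fun a _ => h a))

theorem exists_linAut (k : Type) [Field k] (p : ℕ) [Fact p.Prime] [CharP k p] {C : Type}
    [CommRing C] [Algebra k C] (r : ℕ) (N N' : Matrix (Fin n) (Fin n) C) (h : N * N' = 1)
    (h' : N' * N = 1) :
    ∃ g : Rq C n (p ^ r) ≃ₐ[C] Rq C n (p ^ r), ∀ j,
      Ideal.Quotient.mk (truncIdeal C n (p ^ r)) (linPoly N j) =
      g (Ideal.Quotient.mk (truncIdeal C n (p ^ r)) (X j)) :=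
  exists_truncAut (linPoly N) (linPoly N') (mk_linPoly_pow k p N) (mk_linPoly_pow k p N')
    (aeval_linPoly h) (aeval_linPoly h')

theorem coefMap_rTensor_det_smul {q : ℕ} {C : Type} [CommRing C] [Algebra k C]
    {T : Type} [AddCommMonoid T] [Module k T] (ℓ : C →ₗ[k] k) (d : C) (f : V →ₗ[k] T)
    (x : C ⊗[k] V) :
    (coefMap n q ℓ).rTensor T (algebraMap C (Rq C n q) d • f.baseChange (Rq C n q)
        (((Algebra.ofId C (Rq C n q)).restrictScalars k).toLinearMap.rTensor V x)) =
      1 ⊗ₜ[k] f (TensorProduct.lid k V (ℓ.rTensor V (d • x))) := by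
  induction x using TensorProduct.induction_on with
  | zero => simp
  | add x y hx hy =>
    simp only [map_add, smul_add, TensorProduct.tmul_add, hx, hy]
  | tmul c v =>
    have h := coefMap_smul_baseHom (n := n) (q := q) ℓ (d * c) 1
    have h1 : (d * c) • baseHom k n q C 1 = algebraMap C (Rq C n q) (d * c) := by
      rw [map_one]
      exact (Algebra.algebraMap_eq_smul_one _).symm
    rw [h1] at h
    rw [LinearMap.rTensor_tmul, LinearMap.baseChange_tmul, TensorProduct.smul_tmul',
      LinearMap.rTensor_tmul, TensorProduct.smul_tmul', LinearMap.rTensor_tmul,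
      TensorProduct.lid_tmul, f.map_smul, ← TensorProduct.smul_tmul, smul_eq_mul, smul_eq_mul,
      ← h, (algebraMap C (Rq C n q)).map_mul]
    rfl

theorem lid_rTensor_smul {C : Type} [CommRing C] [Algebra k C] (ℓ : C →ₗ[k] k) (c : C)
    (x : C ⊗[k] V) :
    TensorProduct.lid k V (ℓ.rTensor V (c • x)) =
      TensorProduct.lid k V ((ℓ ∘ₗ LinearMap.mul k C c).rTensor V x) := by
  induction x using TensorProduct.induction_on with
  | zero => simp
  | add x y hx hy => simp only [map_add, smul_add, hx, hy]
  | tmul d v => simp [TensorProduct.smul_tmul']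

variable {σ : ∀ (B : Type) [CommRing B] [Algebra k B],
      GL (Fin n) B →* ((B ⊗[k] V) ≃ₗ[B] (B ⊗[k] V))}
    {ρI : ∀ (B : Type) [CommRing B] [Algebra k B],
      (Rq B n (p ^ r) ≃ₐ[B] Rq B n (p ^ r)) →*
        ((Rq B n (p ^ r) ⊗[k] ((↥(⋀[k]^i (Fin n → k))) ⊗[k] V)) ≃ₗ[B]
          (Rq B n (p ^ r) ⊗[k] ((↥(⋀[k]^i (Fin n → k))) ⊗[k] V)))}
    {W : Submodule k ((Rq k n (p ^ r)) ⊗[k] ((↥(⋀[k]^i (Fin n → k))) ⊗[k] V))}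

/-- A family of representations is natural in the algebra. -/
def NaturalAction (k : Type) [Field k] (n : ℕ) (V : Type) [AddCommGroup V] [Module k V]
    (σ : ∀ (B : Type) [CommRing B] [Algebra k B],
      GL (Fin n) B →* ((B ⊗[k] V) ≃ₗ[B] (B ⊗[k] V))) : Prop :=
  ∀ (B C : Type) [CommRing B] [Algebra k B] [CommRing C] [Algebra k C],
      ∀ (φ : B →ₐ[k] C) (M : GL (Fin n) B) (M' : GL (Fin n) C),
        (∀ a b, (M' : Matrix (Fin n) (Fin n) C) a b = φ ((M : Matrix (Fin n) (Fin n) B) a b)) →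
        ∀ x, σ C M' (TensorProduct.map φ.toLinearMap LinearMap.id x) =
          TensorProduct.map φ.toLinearMap LinearMap.id (σ B M x)

theorem lid_rTensor_minor_mem [Fact p.Prime] [CharP k p] (hr : 1 ≤ r)
    (hσ : NaturalAction k n V σ)
    (hA : ActionFormula k p n (p ^ r) i V σ ρI) (hW : InvPred k n (p ^ r) i V ρI W)
    {v : V} (hv : v ∈ wedgeVectors W) {C : Type} [CommRing C] [Algebra k C] (N M : GL (Fin n) C)
    (hN : ∀ a b, (M : Matrix (Fin n) (Fin n) C) a b =
      (N : Matrix (Fin n) (Fin n) C) a b ^ p) (ℓ : C →ₗ[k] k) (a b : Fin i → Fin n)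
    (hb : StrictMono b) :
    TensorProduct.lid k V (ℓ.rTensor V (((N : Matrix (Fin n) (Fin n) C).submatrix b a).det •
      σ C M (1 ⊗ₜ[k] v))) ∈ wedgeVectors W := by
  obtain ⟨g, hg⟩ := exists_linAut k p r (N : Matrix (Fin n) (Fin n) C) _
    (Units.mul_inv N) (Units.inv_mul N)
  have hact := hA C g _ hg (Matrix.GeneralLinearGroup.map (algebraMap C (Rq C n (p ^ r))) N)
    (Matrix.GeneralLinearGroup.map (algebraMap C (Rq C n (p ^ r))) M) ?_ ?_ 1 a v
  rotate_left
  · intro a b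
    rw [linPoly, map_sum, Finset.sum_eq_single a]
    · simp; rfl
    · intro c _ hc
      simp [hc]
    · simp
  · intro a b
    change algebraMap C (Rq C n (p ^ r)) _ = algebraMap C (Rq C n (p ^ r)) _ ^ p
    rw [hN, map_pow]
  have hnat := hσ C (Rq C n (p ^ r)) ((Algebra.ofId C (Rq C n (p ^ r))).restrictScalars k) M
    (Matrix.GeneralLinearGroup.map (algebraMap C (Rq C n (p ^ r))) M) (fun _ _ => rfl) (1 ⊗ₜ[k] v)
  rw [TensorProduct.map_tmul, AlgHom.toLinearMap_apply, map_one, LinearMap.id_apply] at hnat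
  rw [hnat, map_one, one_smul, wedgeMap_apply] at hact
  have hmem := hW.componentMap_mem g ℓ (mem_wedgeVectors.mp hv a)
  have hc := componentMap_tmul (ρI _ g) ℓ 1 (wedgeTensor k n i V a v)
  rw [map_one, map_one, map_one, hact] at hc
  have hdet : ∀ b : Fin i → Fin n, (Matrix.of fun m l =>
      ((Matrix.GeneralLinearGroup.map (algebraMap C (Rq C n (p ^ r))) N : GL (Fin n) _) :
        Matrix (Fin n) (Fin n) (Rq C n (p ^ r))) (b l) (a m)).det =
      algebraMap C (Rq C n (p ^ r)) ((N : Matrix (Fin n) (Fin n) C).submatrix b a).det := by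
    intro b
    rw [RingHom.map_det, ← Matrix.det_transpose]
    rfl
  simp only [hdet] at hc
  have hc' := hc.trans (map_sum ((coefMap n (p ^ r) ℓ).rTensor _) _ _)
  have hsum : ∑ b ∈ Finset.univ.filter (fun b : Fin i → Fin n => StrictMono b),
      wedgeTensor k n i V b (TensorProduct.lid k V (ℓ.rTensor V
        (((N : Matrix (Fin n) (Fin n) C).submatrix b a).det • σ C M (1 ⊗ₜ[k] v)))) ∈
        constants W := by
    rw [mem_constants, TensorProduct.tmul_sum]
    rw [TensorProduct.mk_apply, hc'] at hmem
    convert hmem using 1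
    exact Finset.sum_congr rfl fun b _ => (coefMap_rTensor_det_smul ℓ _ _ _).symm
  have hmem2 := wedgeTensor_mem_of_sum_mem hr hA hW
    (fun b => TensorProduct.lid k V (ℓ.rTensor V
        (((N : Matrix (Fin n) (Fin n) C).submatrix b a).det • σ C M (1 ⊗ₜ[k] v)))) _
    (fun b hb => (Finset.mem_filter.mp hb).2) hsum
    (Finset.mem_filter.mpr ⟨Finset.mem_univ b, hb⟩)
  exact mem_wedgeVectors.mpr (wedgeTensor_mem_of_injective hr hA hW hb.injective hmem2)

theorem wedgeVectors_invariant [Fact p.Prime] [CharP k p] (hr : 1 ≤ r) (hi : i ≤ n)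
    (hσ : NaturalAction k n V σ)
    (hA : ActionFormula k p n (p ^ r) i V σ ρI) (hW : InvPred k n (p ^ r) i V ρI W)
    (B : Type) [CommRing B] [Algebra k B] (M : GL (Fin n) B) (w : B ⊗[k] V)
    (hw : w ∈ Submodule.span B (⇑(TensorProduct.mk k B V 1) '' (wedgeVectors W : Set V))) :
    σ B M w ∈ Submodule.span B (⇑(TensorProduct.mk k B V 1) '' (wedgeVectors W : Set V)) := by
  induction hw using Submodule.span_induction with
  | zero => rw [map_zero]; exact zero_mem _
  | add x y _ _ hx hy => rw [map_add]; exact add_mem hx hy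
  | smul c x _ hx => rw [map_smul]; exact Submodule.smul_mem _ _ hx
  | mem x h =>
    obtain ⟨v, hv, rfl⟩ := h
    apply mem_span_of_forall_functional
    intro ℓ
    obtain ⟨C, _, _, φ, hφ, hroot⟩ := exists_pow_root_extension k
      (Fact.out : p.Prime).ne_zero B (fun x : Fin n × Fin n =>
        (M : Matrix (Fin n) (Fin n) B) x.1 x.2) Finset.univ
    choose y hy using fun x => hroot x (Finset.mem_univ x)
    let M' : GL (Fin n) C := Matrix.GeneralLinearGroup.map (φ : B →+* C) M
    let N₀ : Matrix (Fin n) (Fin n) C := Matrix.of fun a b => y (a, b)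
    have hdet : IsUnit N₀.det := by
      have h1 : (algFrobenius k p C 1) N₀.det = (M' : Matrix (Fin n) (Fin n) C).det := by
        rw [RingHom.map_det]
        congr 1
        ext a b
        change y (a, b) ^ p ^ 1 = φ _
        rw [pow_one, hy]
      rw [algFrobenius_apply, pow_one] at h1
      have h2 : IsUnit (M' : Matrix (Fin n) (Fin n) C).det :=
        (Matrix.isUnit_iff_isUnit_det _).mp M'.isUnit
      rw [← h1] at h2
      exact (isUnit_pow_iff (Fact.out : p.Prime).ne_zero).mp h2
    let N : GL (Fin n) C := Matrix.GeneralLinearGroup.mk'' N₀ hdet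
    have hN : ∀ a b, (M' : Matrix (Fin n) (Fin n) C) a b =
        (N : Matrix (Fin n) (Fin n) C) a b ^ p := fun a b => (hy (a, b)).symm
    let I : Ideal C :=
      { carrier := {c | ∀ ℓ : C →ₗ[k] k,
          TensorProduct.lid k V (ℓ.rTensor V (c • σ C M' (1 ⊗ₜ[k] v))) ∈ wedgeVectors W}
        zero_mem' := fun ℓ => by rw [zero_smul, map_zero, map_zero]; exact zero_mem _
        add_mem' := fun {x y} hx hy ℓ => by
          rw [add_smul, map_add, map_add]; exact add_mem (hx ℓ) (hy ℓ)
        smul_mem' := fun c x hx ℓ => by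
          rw [smul_eq_mul, mul_smul, lid_rTensor_smul]; exact hx _ }
    have hI : I = ⊤ := ideal_eq_top_of_minors hi N I fun b a hb ℓ =>
      lid_rTensor_minor_mem hr hσ hA hW hv N M' hN ℓ a b hb
    have h1 : (1 : C) ∈ I := by rw [hI]; trivial
    obtain ⟨ψ, hψ⟩ := φ.toLinearMap.exists_leftInverse_of_injective
      (LinearMap.ker_eq_bot.mpr hφ)
    have h2 := h1 (ℓ ∘ₗ ψ)
    have hnat := hσ B C φ M M' (fun _ _ => rfl) (1 ⊗ₜ[k] v)
    rw [TensorProduct.map_tmul, AlgHom.toLinearMap_apply, map_one, LinearMap.id_apply] at hnat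
    rw [one_smul, hnat] at h2
    change TensorProduct.lid k V ((ℓ ∘ₗ ψ).rTensor V (φ.toLinearMap.rTensor V _)) ∈ _ at h2
    rw [← LinearMap.comp_apply, ← LinearMap.rTensor_comp, LinearMap.comp_assoc, hψ,
      LinearMap.comp_id] at h2
    exact h2

end LinearPart

section DeRham

variable {k : Type} [Field k] {p n r i : ℕ} {V : Type} [AddCommGroup V] [Module k V]

/-- The de Rham differential with coefficients in `V`, in terms of the basic wedges. -/
def IsDeRham (k : Type) [Field k] (n q i : ℕ) (V : Type) [AddCommGroup V] [Module k V]
    (d : ((Rq k n q) ⊗[k] ((↥(⋀[k]^i (Fin n → k))) ⊗[k] V)) →ₗ[k]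
      ((Rq k n q) ⊗[k] ((↥(⋀[k]^(i + 1) (Fin n → k))) ⊗[k] V))) : Prop :=
  ∀ (P : MvPolynomial (Fin n) k) (a : Fin i → Fin n) (v : V),
    d (Ideal.Quotient.mk (truncIdeal k n q) P ⊗ₜ[k] wedgeTensor k n i V a v) =
      ∑ j, Ideal.Quotient.mk (truncIdeal k n q) (pderiv j P) ⊗ₜ[k]
        wedgeTensor k n (i + 1) V (Fin.cons j a) v

theorem single_cons (j : Fin n) (a : Fin i → Fin n) :
    (Fin.cons (Pi.single j 1) (fun l => Pi.single (a l) 1) : Fin (i + 1) → (Fin n → k)) =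
      fun l => Pi.single ((Fin.cons j a : Fin (i + 1) → Fin n) l) 1 := by
  funext l
  refine Fin.cases ?_ (fun m => ?_) l
  · rw [Fin.cons_zero, Fin.cons_zero]
  · rw [Fin.cons_succ, Fin.cons_succ]

variable {q : ℕ} {d : ((Rq k n q) ⊗[k] ((↥(⋀[k]^i (Fin n → k))) ⊗[k] V)) →ₗ[k]
      ((Rq k n q) ⊗[k] ((↥(⋀[k]^(i + 1) (Fin n → k))) ⊗[k] V))}

theorem range_le_of_forall {T : Type} [AddCommMonoid T] [Module k T]
    (D : ((Rq k n q) ⊗[k] ((↥(⋀[k]^i (Fin n → k))) ⊗[k] V)) →ₗ[k] T)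
    (W : Submodule k T)
    (h : ∀ (P : MvPolynomial (Fin n) k) (a : Fin i → Fin n) (v : V), Function.Injective a →
      D (Ideal.Quotient.mk (truncIdeal k n q) P ⊗ₜ[k] wedgeTensor k n i V a v) ∈ W) :
    LinearMap.range D ≤ W := by
  rintro _ ⟨x, rfl⟩
  induction x using TensorProduct.induction_on with
  | zero => rw [map_zero]; exact zero_mem _
  | add x y hx hy => rw [map_add]; exact add_mem hx hy
  | tmul f z =>
    obtain ⟨P, rfl⟩ := Ideal.Quotient.mk_surjective f
    induction span_wedgeTensor z using Submodule.span_induction with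
    | zero => rw [TensorProduct.tmul_zero, map_zero]; exact zero_mem _
    | add x y _ _ hx hy => rw [TensorProduct.tmul_add, map_add]; exact add_mem hx hy
    | smul c x _ hx => rw [TensorProduct.tmul_smul, map_smul]; exact Submodule.smul_mem _ _ hx
    | mem x hx =>
      obtain ⟨a, v, ha, rfl⟩ := hx
      exact h P a v ha.injective

end DeRham

section MinimalInvariant

variable {k : Type} [Field k] {p n r i : ℕ} {V : Type} [AddCommGroup V] [Module k V]
    {σ : ∀ (B : Type) [CommRing B] [Algebra k B],
      GL (Fin n) B →* ((B ⊗[k] V) ≃ₗ[B] (B ⊗[k] V))}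
    {ρI : ∀ (B : Type) [CommRing B] [Algebra k B],
      (Rq B n (p ^ r) ≃ₐ[B] Rq B n (p ^ r)) →*
        ((Rq B n (p ^ r) ⊗[k] ((↥(⋀[k]^(i + 1) (Fin n → k))) ⊗[k] V)) ≃ₗ[B]
          (Rq B n (p ^ r) ⊗[k] ((↥(⋀[k]^(i + 1) (Fin n → k))) ⊗[k] V)))}
    {W : Submodule k ((Rq k n (p ^ r)) ⊗[k] ((↥(⋀[k]^(i + 1) (Fin n → k))) ⊗[k] V))}

theorem range_deRham_le [Fact p.Prime] [CharP k p] (hr : 1 ≤ r) (hi : i + 1 ≤ n)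
    (hσ : NaturalAction k n V σ)
    (hirr : ∀ W : Submodule k V,
      (∀ (B : Type) [CommRing B] [Algebra k B],
        ∀ (M : GL (Fin n) B) (w : B ⊗[k] V),
          w ∈ Submodule.span B (⇑(TensorProduct.mk k B V 1) '' (W : Set V)) →
          σ B M w ∈ Submodule.span B (⇑(TensorProduct.mk k B V 1) '' (W : Set V))) →
      W = ⊥ ∨ W = ⊤)
    (hA : ActionFormula k p n (p ^ r) (i + 1) V σ ρI)
    (hW : InvPred k n (p ^ r) (i + 1) V ρI W) (hW0 : W ≠ ⊥)
    {d : ((Rq k n (p ^ r)) ⊗[k] ((↥(⋀[k]^i (Fin n → k))) ⊗[k] V)) →ₗ[k]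
      ((Rq k n (p ^ r)) ⊗[k] ((↥(⋀[k]^(i + 1) (Fin n → k))) ⊗[k] V))}
    (hd : IsDeRham k n (p ^ r) i V d) : LinearMap.range d ≤ W := by
  have htop : wedgeVectors W = ⊤ :=
    (hirr _ fun B _ _ M w hw => wedgeVectors_invariant hr hi hσ hA hW B M w hw).resolve_left
      (wedgeVectors_ne_bot hr hA hW hW0)
  refine range_le_of_forall d W fun P a v ha => ?_
  obtain ⟨c, hc⟩ : ∃ c, c ∉ Set.range a := by
    by_contra! h
    have := Fintype.card_le_of_surjective a h
    simp only [Fintype.card_fin] at this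
    omega
  have hv : v ∈ wedgeVectors W := by rw [htop]; trivial
  obtain ⟨L, hL, -, hL2⟩ := exists_lieOperator hr hA P c
  have h1 := hL W hW _ (mem_constants.mp (mem_wedgeVectors.mp hv (Fin.cons c a)))
  rw [hL2 (Fin.cons c a) v 0 (Fin.cons_injective_iff.mpr ⟨hc, ha⟩) (Fin.cons_zero _ _)] at h1
  rw [hd]
  convert h1 using 4 with j
  rw [Fin.update_cons_zero]

end MinimalInvariant

section ExactForms

theorem derivation_prod {R A : Type} [CommRing R] [CommRing A] [Algebra R A]
    {ι : Type} [DecidableEq ι] (D : Derivation R A A) (s : Finset ι) (h : ι → A) :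
    D (∏ m ∈ s, h m) = ∑ l ∈ s, (∏ m ∈ s.erase l, h m) * D (h l) := by
  induction s using Finset.induction_on with
  | empty => simp
  | insert c s hc ih =>
    rw [Finset.prod_insert hc, Derivation.leibniz, ih, Finset.sum_insert hc,
      Finset.erase_insert hc, add_comm, smul_eq_mul, smul_eq_mul, Finset.mul_sum]
    congr 1
    refine Finset.sum_congr rfl fun l hl => ?_
    have hlc : c ≠ l := fun h => hc (h ▸ hl)
    rw [Finset.erase_insert_of_ne hlc, Finset.prod_insert (fun h => hc (Finset.mem_of_mem_erase h)),
      mul_assoc]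

theorem pderiv_pderiv_comm {B : Type} [CommRing B] {n : ℕ} (j l : Fin n)
    (P : MvPolynomial (Fin n) B) :
    pderiv j (pderiv l P) = pderiv l (pderiv j P) := by
  have h : ⁅(pderiv j : Derivation B (MvPolynomial (Fin n) B) (MvPolynomial (Fin n) B)),
      (pderiv l : Derivation B (MvPolynomial (Fin n) B) (MvPolynomial (Fin n) B))⁆ = 0 := by
    apply MvPolynomial.derivation_ext
    intro m
    rw [Derivation.commutator_apply, pderiv_X, pderiv_X]
    simp [Pi.single_apply, apply_ite]
  have h2 := congrArg (fun D => D P) h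
  simpa [Derivation.commutator_apply, sub_eq_zero] using h2

variable {k : Type} [Field k] {p n q i : ℕ} {V : Type} [AddCommGroup V] [Module k V]

theorem wedgeTensor_add_swap (b : Fin i → Fin n) {l m : Fin i} (h : l ≠ m) (v : V) :
    wedgeTensor k n i V b v + wedgeTensor k n i V (b ∘ Equiv.swap l m) v = 0 := by
  rw [wedgeTensor_apply, wedgeTensor_apply, ← TensorProduct.add_tmul, wedgeGen_eq_ιMulti,
    wedgeGen_eq_ιMulti]
  have := (exteriorPower.ιMulti k i (M := Fin n → k)).map_add_swap
    (fun l => Pi.single (b l) 1) h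
  rw [show (fun x => Pi.single ((b ∘ Equiv.swap l m) x) (1 : k)) =
    (fun l => Pi.single (b l) (1 : k)) ∘ Equiv.swap l m from rfl, this, TensorProduct.zero_tmul]

theorem sum_tmul_wedgeTensor_eq_zero {A : Type} [CommRing A] [Algebra k A]
    {l m : Fin i} (h : l ≠ m) (t : (Fin i → Fin n) → A)
    (ht : ∀ b, t (b ∘ Equiv.swap l m) = t b) (v : V) :
    ∑ b, t b ⊗ₜ[k] wedgeTensor k n i V b v = 0 := by
  refine Finset.sum_involution (fun b _ => b ∘ Equiv.swap l m) ?_ ?_ ?_ ?_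
  · intro b _
    rw [ht, ← TensorProduct.tmul_add, wedgeTensor_add_swap b h, TensorProduct.tmul_zero]
  · intro b _ hb hfix
    apply hb
    rw [wedgeTensor_of_not_injective, LinearMap.zero_apply, TensorProduct.tmul_zero]
    intro hinj
    have := congrFun hfix l
    rw [Function.comp_apply, Equiv.swap_apply_left] at this
    exact h (hinj this).symm
  · intro b _; exact Finset.mem_univ _
  · intro b _
    funext x
    simp

theorem pderiv_mul_prod_pderiv {B : Type} [CommRing B] (f : Fin (i + 1) → MvPolynomial (Fin n) B)
    (b : Fin (i + 1) → Fin n) :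
    pderiv (b 0) (f 0 * ∏ m : Fin i, pderiv (b m.succ) (f m.succ)) =
      (∏ m, pderiv (b m) (f m)) + ∑ l : Fin i, f 0 *
        ((∏ m ∈ Finset.univ.erase l, pderiv (b m.succ) (f m.succ)) *
          pderiv (b 0) (pderiv (b l.succ) (f l.succ))) := by
  rw [Derivation.leibniz, derivation_prod, smul_eq_mul, smul_eq_mul, Finset.mul_sum, add_comm,
    Fin.prod_univ_succ, mul_comm (∏ m : Fin i, pderiv (b m.succ) (f m.succ))]

theorem sum_second_order_eq_zero {B : Type} [CommRing B] [Algebra k B]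
    (f : Fin (i + 1) → MvPolynomial (Fin n) B) (l : Fin i) (v : V) :
    ∑ b : Fin (i + 1) → Fin n, Ideal.Quotient.mk (truncIdeal B n q) (f 0 *
        ((∏ m ∈ Finset.univ.erase l, pderiv (b m.succ) (f m.succ)) *
          pderiv (b 0) (pderiv (b l.succ) (f l.succ)))) ⊗ₜ[k]
          wedgeTensor k n (i + 1) V b v = 0 := by
  refine sum_tmul_wedgeTensor_eq_zero (l := 0) (m := l.succ) (Fin.succ_ne_zero l).symm
    (fun b => Ideal.Quotient.mk (truncIdeal B n q) (f 0 *
        ((∏ m ∈ Finset.univ.erase l, pderiv (b m.succ) (f m.succ)) *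
          pderiv (b 0) (pderiv (b l.succ) (f l.succ))))) (fun b => ?_) v
  have hprod : ∏ m ∈ Finset.univ.erase l,
      pderiv ((b ∘ Equiv.swap 0 l.succ) m.succ) (f m.succ) =
        ∏ m ∈ Finset.univ.erase l, pderiv (b m.succ) (f m.succ) :=
    Finset.prod_congr rfl fun m hm => by
      rw [Function.comp_apply, Equiv.swap_apply_of_ne_of_ne (Fin.succ_ne_zero m)
        (fun h => (Finset.mem_erase.mp hm).1 (Fin.succ_injective _ h))]
  simp only [hprod]
  rw [Function.comp_apply, Function.comp_apply, Equiv.swap_apply_left, Equiv.swap_apply_right,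
    pderiv_pderiv_comm]

theorem sum_tmul_add_sum {A T ι κ : Type} [CommRing A] [Algebra k A] [AddCommMonoid T] [Module k T]
    [Fintype ι] [Fintype κ] (x : ι → A) (y : ι → κ → A) (t : ι → T)
    (h : ∀ l, ∑ b, y b l ⊗ₜ[k] t b = 0) :
    ∑ b, (x b + ∑ l, y b l) ⊗ₜ[k] t b = ∑ b, x b ⊗ₜ[k] t b := by
  simp only [TensorProduct.add_tmul, TensorProduct.sum_tmul, Finset.sum_add_distrib]
  rw [Finset.sum_comm, Finset.sum_eq_zero fun l _ => h l, add_zero]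

theorem sum_fin_succ_fun {T : Type} [AddCommMonoid T] (F : (Fin (i + 1) → Fin n) → T) :
    ∑ b, F b = ∑ a : Fin i → Fin n, ∑ j, F (Fin.cons j a) := by
  rw [← (Fin.consEquiv fun _ => Fin n).sum_comp, Fintype.sum_prod_type_right]
  rfl

/-- The wedge of exact forms is the differential of a form. -/
theorem sum_prod_pderiv_eq {B : Type} [CommRing B] [Algebra k B]
    (f : Fin (i + 1) → MvPolynomial (Fin n) B) (v : V) :
    ∑ b : Fin (i + 1) → Fin n, Ideal.Quotient.mk (truncIdeal B n q)
        (∏ m, pderiv (b m) (f m)) ⊗ₜ[k] wedgeTensor k n (i + 1) V b v =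
      ∑ a : Fin i → Fin n, ∑ j, Ideal.Quotient.mk (truncIdeal B n q)
        (pderiv j (f 0 * ∏ m : Fin i, pderiv (a m) (f m.succ))) ⊗ₜ[k]
          wedgeTensor k n (i + 1) V (Fin.cons j a) v := by
  refine Eq.trans ?_ (sum_fin_succ_fun fun b : Fin (i + 1) → Fin n =>
    Ideal.Quotient.mk (truncIdeal B n q)
        (pderiv (b 0) (f 0 * ∏ m : Fin i, pderiv (b m.succ) (f m.succ))) ⊗ₜ[k]
          wedgeTensor k n (i + 1) V b v)
  have h := fun b : Fin (i + 1) → Fin n =>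
    (congrArg (Ideal.Quotient.mk (truncIdeal B n q)) (pderiv_mul_prod_pderiv f b)).trans
      (((Ideal.Quotient.mk (truncIdeal B n q)).map_add _ _).trans
        (congrArg _ (map_sum (Ideal.Quotient.mk (truncIdeal B n q)) _ _)))
  refine Eq.trans (Eq.symm (sum_tmul_add_sum _ _ _ fun l => sum_second_order_eq_zero f l v)) ?_
  exact Finset.sum_congr rfl fun b _ => by rw [h b]

end ExactForms

section HorizontalConstants

variable {k : Type} [Field k] {p n q i : ℕ} {V : Type} [AddCommGroup V] [Module k V]

/-- The subalgebra of elements of `R(n,r)_B` all of whose partial derivatives vanish. -/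
noncomputable def horizontal (k : Type) [Field k] (n q : ℕ) (B : Type) [CommRing B] [Algebra k B] :
    Subalgebra k (Rq B n q) where
  carrier := {c | ∃ P : MvPolynomial (Fin n) B, Ideal.Quotient.mk (truncIdeal B n q) P = c ∧
    ∀ j, Ideal.Quotient.mk (truncIdeal B n q) (pderiv j P) = 0}
  mul_mem' := by
    rintro _ _ ⟨P, rfl, hP⟩ ⟨Q, rfl, hQ⟩
    refine ⟨P * Q, map_mul _ _ _, fun j => ?_⟩
    rw [Derivation.leibniz, smul_eq_mul, smul_eq_mul, map_add, map_mul, map_mul, hP, hQ, mul_zero,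
      mul_zero, add_zero]
  add_mem' := by
    rintro _ _ ⟨P, rfl, hP⟩ ⟨Q, rfl, hQ⟩
    refine ⟨P + Q, map_add _ _ _, fun j => ?_⟩
    rw [map_add, map_add, hP, hQ, add_zero]
  algebraMap_mem' c := ⟨C (algebraMap k B c), rfl, fun j => by rw [pderiv_C, map_zero]⟩

theorem algFrobenius_mem_horizontal [Fact p.Prime] [CharP k p] {B : Type} [CommRing B]
    [Algebra k B] (x : Rq B n q) : algFrobenius k p (Rq B n q) 1 x ∈ horizontal k n q B := by
  obtain ⟨P, rfl⟩ := Ideal.Quotient.mk_surjective x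
  refine ⟨P ^ p ^ 1, map_pow _ _ _, fun j => ?_⟩
  rw [pow_one, Derivation.leibniz_pow, ← Nat.cast_smul_eq_nsmul B,
    charP_cast_eq_zero_of_algebra k p B, zero_smul, map_zero]

variable {B : Type} [CommRing B] [Algebra k B]
  {S : Submodule B (Rq B n q ⊗[k] ((↥(⋀[k]^(i + 1) (Fin n → k))) ⊗[k] V))}

theorem wedgeMap_gradient_mem
    (hS : ∀ (f : MvPolynomial (Fin n) B) (a : Fin i → Fin n) (v : V),
      ∑ j, Ideal.Quotient.mk (truncIdeal B n q) (pderiv j f) ⊗ₜ[k]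
        wedgeTensor k n (i + 1) V (Fin.cons j a) v ∈ S)
    (f : Fin (i + 1) → MvPolynomial (Fin n) B) (v : V) :
    wedgeMap (Rq B n q) (1 ⊗ₜ[k] v)
      (fun m j => Ideal.Quotient.mk (truncIdeal B n q) (pderiv j (f m))) ∈ S := by
  have h : wedgeMap (Rq B n q) (1 ⊗ₜ[k] v)
      (fun m j => Ideal.Quotient.mk (truncIdeal B n q) (pderiv j (f m))) =
      ∑ b : Fin (i + 1) → Fin n, Ideal.Quotient.mk (truncIdeal B n q)
        (∏ m, pderiv (b m) (f m)) ⊗ₜ[k] wedgeTensor k n (i + 1) V b v := by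
    rw [wedgeMap_expand]
    refine Finset.sum_congr rfl fun b _ => ?_
    rw [LinearMap.baseChange_tmul, TensorProduct.smul_tmul', smul_eq_mul, mul_one, map_prod]
  rw [h, sum_prod_pderiv_eq]
  exact S.sum_mem fun a _ => hS _ a v

theorem wedgeMap_gradient_mem_of_horizontal
    (hS : ∀ (f : MvPolynomial (Fin n) B) (a : Fin i → Fin n) (v : V),
      ∑ j, Ideal.Quotient.mk (truncIdeal B n q) (pderiv j f) ⊗ₜ[k]
        wedgeTensor k n (i + 1) V (Fin.cons j a) v ∈ S)
    (f : Fin (i + 1) → MvPolynomial (Fin n) B) (y : horizontal k n q B ⊗[k] V) :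
    wedgeMap (Rq B n q)
      (TensorProduct.map (horizontal k n q B).val.toLinearMap LinearMap.id y)
      (fun m j => Ideal.Quotient.mk (truncIdeal B n q) (pderiv j (f m))) ∈ S := by
  induction y using TensorProduct.induction_on with
  | zero => rw [map_zero, wedgeMap_zero]; exact S.zero_mem
  | add x y hx hy => rw [map_add, wedgeMap_add]; exact S.add_mem hx hy
  | tmul c v =>
    obtain ⟨c, P, rfl, hP⟩ := c
    have h1 : (Ideal.Quotient.mk (truncIdeal B n q) P) ⊗ₜ[k] v =
        Ideal.Quotient.mk (truncIdeal B n q) P • ((1 : Rq B n q) ⊗ₜ[k] v) := by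
      rw [TensorProduct.smul_tmul', smul_eq_mul, mul_one]
    rw [TensorProduct.map_tmul, LinearMap.id_apply]
    change wedgeMap (Rq B n q) (Ideal.Quotient.mk (truncIdeal B n q) P ⊗ₜ[k] v) _ ∈ S
    rw [h1, wedgeMap_smul]
    have h2 := (wedgeMap (k := k) (n := n) (i := i + 1) (V := V) (Rq B n q)
      (1 ⊗ₜ[k] v)).map_update_smul
      (fun m j => Ideal.Quotient.mk (truncIdeal B n q) (pderiv j (f m))) 0
      (Ideal.Quotient.mk (truncIdeal B n q) P)
      (fun j => Ideal.Quotient.mk (truncIdeal B n q) (pderiv j (f 0)))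
    rw [Function.update_eq_self 0
      (fun m j => Ideal.Quotient.mk (truncIdeal B n q) (pderiv j (f m)))] at h2
    rw [← h2]
    convert wedgeMap_gradient_mem hS (Function.update f 0 (P * f 0)) v using 2
    funext m
    rcases eq_or_ne m 0 with rfl | hm
    · rw [Function.update_self, Function.update_self]
      funext j
      rw [Derivation.leibniz, smul_eq_mul, smul_eq_mul, map_add, map_mul, map_mul, hP, mul_zero,
        add_zero]
      rfl
    · rw [Function.update_of_ne hm, Function.update_of_ne hm]

theorem sum_smul_wedgeMap_update {C : Type} [CommRing C] [Algebra k C] (s : C ⊗[k] V)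
    (A : Fin i → Fin n → C) (l : Fin i) (c : Fin n → C) (u : Fin n → Fin n → C) :
    ∑ j, c j • wedgeMap C s (Function.update A l (u j)) =
      wedgeMap C s (Function.update A l (fun j' => ∑ j, c j * u j j')) := by
  have h : (fun j' => ∑ j, c j * u j j') = ∑ j, c j • u j := by
    funext j'
    rw [Finset.sum_apply]
    rfl
  rw [h, AlternatingMap.map_update_sum]
  exact Finset.sum_congr rfl fun j _ => (AlternatingMap.map_update_smul _ _ _ _ _).symm

variable {σ : ∀ (B : Type) [CommRing B] [Algebra k B],
      GL (Fin n) B →* ((B ⊗[k] V) ≃ₗ[B] (B ⊗[k] V))}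
    {ρI : ∀ (B : Type) [CommRing B] [Algebra k B],
      (Rq B n q ≃ₐ[B] Rq B n q) →*
        ((Rq B n q ⊗[k] ((↥(⋀[k]^(i + 1) (Fin n → k))) ⊗[k] V)) ≃ₗ[B]
          (Rq B n q ⊗[k] ((↥(⋀[k]^(i + 1) (Fin n → k))) ⊗[k] V)))}

theorem exists_descent_of_frobenius [Fact p.Prime] [CharP k p] (hσ : NaturalAction k n V σ)
    {A : Type} [CommRing A] [Algebra k A] (K : Subalgebra k A)
    (hK : ∀ x, algFrobenius k p A 1 x ∈ K) (J : GL (Fin n) A) (v : V) :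
    ∃ y : K ⊗[k] V, σ A (Matrix.GeneralLinearGroup.map (algFrobenius k p A 1) J) (1 ⊗ₜ[k] v) =
      TensorProduct.map K.val.toLinearMap LinearMap.id y := by
  let J' : GL (Fin n) K :=
    Matrix.GeneralLinearGroup.map ((algFrobenius k p A 1).codRestrict K hK) J
  have hnat := hσ K A K.val J'
    (Matrix.GeneralLinearGroup.map (algFrobenius k p A 1) J) (fun _ _ => rfl) (1 ⊗ₜ[k] v)
  rw [TensorProduct.map_tmul, AlgHom.toLinearMap_apply, map_one, LinearMap.id_apply] at hnat
  exact ⟨_, hnat⟩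

theorem action_tmul_cons (hA : ActionFormula k p n q (i + 1) V σ ρI)
    (g : Rq B n q ≃ₐ[B] Rq B n q) (Pg : Fin n → MvPolynomial (Fin n) B)
    (hPg : ∀ j, Ideal.Quotient.mk (truncIdeal B n q) (Pg j) =
      g (Ideal.Quotient.mk (truncIdeal B n q) (X j))) (J J' : GL (Fin n) (Rq B n q))
    (hJ : ∀ a b, (J : Matrix (Fin n) (Fin n) (Rq B n q)) a b =
      Ideal.Quotient.mk (truncIdeal B n q) (pderiv a (Pg b)))
    (hJ' : ∀ a b, (J' : Matrix (Fin n) (Fin n) (Rq B n q)) a b =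
      (J : Matrix (Fin n) (Fin n) (Rq B n q)) a b ^ p)
    (f : Rq B n q) (P : MvPolynomial (Fin n) B) (a : Fin i → Fin n) (j : Fin n) (v : V) :
    ρI B g (f ⊗ₜ[k] wedgeTensor k n (i + 1) V (Fin.cons j a) v) =
      g f • wedgeMap (Rq B n q) (σ _ J' (1 ⊗ₜ[k] v))
        (Function.update (fun m j => Ideal.Quotient.mk (truncIdeal B n q)
          (pderiv j ((Fin.cons P (fun l => Pg (a l)) :
            Fin (i + 1) → MvPolynomial (Fin n) B) m))) 0
          (fun j' => Ideal.Quotient.mk (truncIdeal B n q) (pderiv j' (Pg j)))) := by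
  refine (hA B g Pg hPg J J' hJ hJ' f (Fin.cons j a) v).trans ?_
  have h : (fun m j' => (J : Matrix (Fin n) (Fin n) (Rq B n q)) j'
      ((Fin.cons j a : Fin (i + 1) → Fin n) m)) =
      (Function.update (fun m j => Ideal.Quotient.mk (truncIdeal B n q)
          (pderiv j ((Fin.cons P (fun l => Pg (a l)) :
            Fin (i + 1) → MvPolynomial (Fin n) B) m))) 0
          (fun j' => Ideal.Quotient.mk (truncIdeal B n q) (pderiv j' (Pg j)))) := by
    funext m
    refine Fin.cases ?_ (fun l => ?_) m
    · rw [Function.update_self, Fin.cons_zero]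
      funext j'
      exact hJ _ _
    · rw [Function.update_of_ne (Fin.succ_ne_zero l), Fin.cons_succ, Fin.cons_succ]
      funext j'
      exact hJ _ _
  exact congrArg (fun A => g f • wedgeMap (Rq B n q) (σ _ J' (1 ⊗ₜ[k] v)) A) h

theorem action_exact_mem [Fact p.Prime] [CharP k p] (hq : (q : B) = 0)
    (hσ : NaturalAction k n V σ) (hA : ActionFormula k p n q (i + 1) V σ ρI)
    (hS : ∀ (f : MvPolynomial (Fin n) B) (a : Fin i → Fin n) (v : V),
      ∑ j, Ideal.Quotient.mk (truncIdeal B n q) (pderiv j f) ⊗ₜ[k]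
        wedgeTensor k n (i + 1) V (Fin.cons j a) v ∈ S)
    (g : Rq B n q ≃ₐ[B] Rq B n q) (P : MvPolynomial (Fin n) B) (a : Fin i → Fin n) (v : V) :
    ρI B g (∑ j, Ideal.Quotient.mk (truncIdeal B n q) (pderiv j P) ⊗ₜ[k]
        wedgeTensor k n (i + 1) V (Fin.cons j a) v) ∈ S := by
  choose Pg hPg using fun j => Ideal.Quotient.mk_surjective
    (g (Ideal.Quotient.mk (truncIdeal B n q) (X j)))
  obtain ⟨J, hJ⟩ := exists_jacobian hq g Pg hPg
  have hF : ∀ a b, ((Matrix.GeneralLinearGroup.map (algFrobenius k p (Rq B n q) 1) J :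
      GL (Fin n) (Rq B n q)) : Matrix (Fin n) (Fin n) (Rq B n q)) a b =
      (J : Matrix (Fin n) (Fin n) (Rq B n q)) a b ^ p := fun a b =>
    (algFrobenius_apply k p (Rq B n q) 1 _).trans (congrArg _ (pow_one p))
  obtain ⟨y, hy⟩ := exists_descent_of_frobenius (p := p) hσ (horizontal k n q B)
    algFrobenius_mem_horizontal J v
  have h1 := (map_sum (ρI B g) (fun j => Ideal.Quotient.mk (truncIdeal B n q) (pderiv j P) ⊗ₜ[k]
        wedgeTensor k n (i + 1) V (Fin.cons j a) v) Finset.univ).trans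
    ((Finset.sum_congr rfl fun j _ => action_tmul_cons hA g Pg hPg J _ hJ hF
      (Ideal.Quotient.mk (truncIdeal B n q) (pderiv j P)) (aeval Pg P) a j v).trans
      (sum_smul_wedgeMap_update _ _ 0 _ _))
  rw [h1, hy]
  convert wedgeMap_gradient_mem_of_horizontal hS
    (Fin.cons (aeval Pg P) (fun l => Pg (a l))) y using 2
  funext m
  rcases eq_or_ne m 0 with rfl | hm
  · rw [Function.update_self]
    funext j'
    exact (mk_pderiv_aeval g.toAlgHom Pg hPg j' P).symm
  · rw [Function.update_of_ne hm]

end HorizontalConstants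

section RangeInvariant

variable {k : Type} [Field k] {p n r q i : ℕ} {V : Type} [AddCommGroup V] [Module k V]

/-- An extension of scalars map, given on pure tensors. -/
def IsScalarExtension {T : Type} [AddCommMonoid T] [Module k T] {B : Type} [CommRing B]
    [Algebra k B] (θ : (Rq k n q) ⊗[k] T →ₗ[k] (Rq B n q) ⊗[k] T) : Prop :=
  ∀ (P : MvPolynomial (Fin n) k) (w : T),
    θ (Ideal.Quotient.mk (truncIdeal k n q) P ⊗ₜ[k] w) =
      Ideal.Quotient.mk (truncIdeal B n q) (MvPolynomial.map (algebraMap k B) P) ⊗ₜ[k] w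

variable {B : Type} [CommRing B] [Algebra k B]
  {d : ((Rq k n q) ⊗[k] ((↥(⋀[k]^i (Fin n → k))) ⊗[k] V)) →ₗ[k]
      ((Rq k n q) ⊗[k] ((↥(⋀[k]^(i + 1) (Fin n → k))) ⊗[k] V))}
  {θ : ((Rq k n q) ⊗[k] ((↥(⋀[k]^(i + 1) (Fin n → k))) ⊗[k] V)) →ₗ[k]
        ((Rq B n q) ⊗[k] ((↥(⋀[k]^(i + 1) (Fin n → k))) ⊗[k] V))}

theorem scalarExtension_deRham (hd : IsDeRham k n q i V d) (hθ : IsScalarExtension θ)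
    (P : MvPolynomial (Fin n) k) (a : Fin i → Fin n) (v : V) :
    θ (d (Ideal.Quotient.mk (truncIdeal k n q) P ⊗ₜ[k] wedgeTensor k n i V a v)) =
      ∑ j, Ideal.Quotient.mk (truncIdeal B n q)
        (pderiv j (MvPolynomial.map (algebraMap k B) P)) ⊗ₜ[k]
          wedgeTensor k n (i + 1) V (Fin.cons j a) v := by
  rw [hd]
  refine (map_sum θ _ _).trans (Finset.sum_congr rfl fun j _ => ?_)
  rw [hθ, pderiv_map]

theorem sum_mk_pderiv_mem_span (hd : IsDeRham k n q i V d) (hθ : IsScalarExtension θ)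
    (f : MvPolynomial (Fin n) B) (a : Fin i → Fin n) (v : V) :
    ∑ j, Ideal.Quotient.mk (truncIdeal B n q) (pderiv j f) ⊗ₜ[k]
        wedgeTensor k n (i + 1) V (Fin.cons j a) v ∈
      Submodule.span B (⇑θ '' (LinearMap.range d : Set _)) := by
  induction f using MvPolynomial.induction_on' with
  | add f g hf hg =>
    have h : ∀ j, Ideal.Quotient.mk (truncIdeal B n q) (pderiv j (f + g)) ⊗ₜ[k]
        wedgeTensor k n (i + 1) V (Fin.cons j a) v =
        Ideal.Quotient.mk (truncIdeal B n q) (pderiv j f) ⊗ₜ[k]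
          wedgeTensor k n (i + 1) V (Fin.cons j a) v +
        Ideal.Quotient.mk (truncIdeal B n q) (pderiv j g) ⊗ₜ[k]
          wedgeTensor k n (i + 1) V (Fin.cons j a) v := fun j => by
      rw [map_add, map_add, TensorProduct.add_tmul]
    rw [Finset.sum_congr rfl fun j _ => h j, Finset.sum_add_distrib]
    exact Submodule.add_mem _ hf hg
  | monomial u b =>
    have h : ∀ j, Ideal.Quotient.mk (truncIdeal B n q) (pderiv j (monomial u b)) ⊗ₜ[k]
        wedgeTensor k n (i + 1) V (Fin.cons j a) v =
        b • (Ideal.Quotient.mk (truncIdeal B n q)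
          (pderiv j (MvPolynomial.map (algebraMap k B) (monomial u 1))) ⊗ₜ[k]
          wedgeTensor k n (i + 1) V (Fin.cons j a) v) := fun j => by
      have h1 : monomial u b = b • MvPolynomial.map (algebraMap k B) (monomial u 1) := by
        rw [map_monomial, map_one, smul_monomial, smul_eq_mul, mul_one]
      rw [h1, Derivation.map_smul, TensorProduct.smul_tmul']
      rfl
    rw [Finset.sum_congr rfl fun j _ => h j, ← Finset.smul_sum, ← scalarExtension_deRham hd hθ]
    exact Submodule.smul_mem _ _ (Submodule.subset_span ⟨_, ⟨_, rfl⟩, rfl⟩)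

variable {σ : ∀ (B : Type) [CommRing B] [Algebra k B],
      GL (Fin n) B →* ((B ⊗[k] V) ≃ₗ[B] (B ⊗[k] V))}
    {ρI : ∀ (B : Type) [CommRing B] [Algebra k B],
      (Rq B n q ≃ₐ[B] Rq B n q) →*
        ((Rq B n q ⊗[k] ((↥(⋀[k]^(i + 1) (Fin n → k))) ⊗[k] V)) ≃ₗ[B]
          (Rq B n q ⊗[k] ((↥(⋀[k]^(i + 1) (Fin n → k))) ⊗[k] V)))}

theorem range_deRham_invariant [Fact p.Prime] [CharP k p] (hpq : p ∣ q)
    (hσ : NaturalAction k n V σ) (hA : ActionFormula k p n q (i + 1) V σ ρI)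
    (hd : IsDeRham k n q i V d) : InvPred k n q (i + 1) V ρI (LinearMap.range d) := by
  intro B _ _ θ hθ g w hw
  have hq : (q : B) = 0 := by
    obtain ⟨m, rfl⟩ := hpq
    rw [Nat.cast_mul, charP_cast_eq_zero_of_algebra k p B, zero_mul]
  set S := Submodule.span B (⇑θ '' (LinearMap.range d : Set _)) with hS
  induction hw using Submodule.span_induction with
  | zero => rw [map_zero]; exact S.zero_mem
  | add x y _ _ hx hy => rw [map_add]; exact S.add_mem hx hy
  | smul c x _ hx => rw [map_smul]; exact S.smul_mem _ hx
  | mem x h =>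
    obtain ⟨_, hy, rfl⟩ := h
    let D := ((ρI B g).toLinearMap.restrictScalars k) ∘ₗ θ
    have hle : LinearMap.range (D ∘ₗ d) ≤ S.restrictScalars k :=
      range_le_of_forall (D ∘ₗ d) (S.restrictScalars k) fun P a v _ => by
        change ρI B g (θ (d _)) ∈ S
        rw [scalarExtension_deRham hd hθ]
        exact action_exact_mem hq hσ hA (sum_mk_pderiv_mem_span hd hθ) g _ a v
    obtain ⟨z, rfl⟩ := hy
    exact hle ⟨z, rfl⟩

end RangeInvariant

section RangeNonzero

variable {k : Type} [Field k] {n q i : ℕ} {V : Type} [AddCommGroup V] [Module k V]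

theorem one_tmul_ne_zero {T : Type} [AddCommMonoid T] [Module k T] (hq : 0 < q) {t : T}
    (ht : t ≠ 0) : (1 : Rq k n q) ⊗ₜ[k] t ≠ 0 := by
  intro h
  have h1 := congrArg (fun x => TensorProduct.lid k T
    ((truncCoeff (k := k) (n := n) (q := q) (β := 0) (fun _ => hq)).rTensor T x)) h
  simp only [map_zero, LinearMap.rTensor_tmul, TensorProduct.lid_tmul] at h1
  have h2 : truncCoeff (k := k) (n := n) (q := q) (β := 0) (fun _ => hq) 1 = 1 := by
    rw [← (Ideal.Quotient.mk (truncIdeal k n q)).map_one, truncCoeff_mk, coeff_zero_one]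
  rw [h2, one_smul] at h1
  exact ht h1

theorem exists_wedgeTensor_ne_zero [FiniteDimensional k V] [Nontrivial V] (hi : i ≤ n) :
    ∃ (b : Fin i → Fin n) (v : V), wedgeTensor k n i V b v ≠ 0 := by
  by_contra! h
  have h0 : ∀ z : (↥(⋀[k]^i (Fin n → k))) ⊗[k] V, z = 0 := fun z => by
    obtain ⟨v, rfl⟩ := exists_wedgeTensor_expansion z
    exact Finset.sum_eq_zero fun b _ => h b _
  have : Subsingleton ((↥(⋀[k]^i (Fin n → k))) ⊗[k] V) :=
    ⟨fun x y => (h0 x).trans (h0 y).symm⟩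
  have h1 := Module.finrank_zero_of_subsingleton (R := k)
    (M := (↥(⋀[k]^i (Fin n → k))) ⊗[k] V)
  rw [Module.finrank_tensorProduct, exteriorPower.finrank_eq, Module.finrank_fin_fun,
    mul_eq_zero] at h1
  exact h1.elim (Nat.choose_pos hi).ne' (Module.finrank_pos (R := k) (M := V)).ne'

theorem range_deRham_ne_bot [FiniteDimensional k V] [Nontrivial V] (hq : 0 < q) (hi : i + 1 ≤ n)
    {d : ((Rq k n q) ⊗[k] ((↥(⋀[k]^i (Fin n → k))) ⊗[k] V)) →ₗ[k]
      ((Rq k n q) ⊗[k] ((↥(⋀[k]^(i + 1) (Fin n → k))) ⊗[k] V))}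
    (hd : IsDeRham k n q i V d) : LinearMap.range d ≠ ⊥ := by
  obtain ⟨b, v, hb⟩ := exists_wedgeTensor_ne_zero (k := k) (V := V) hi
  intro h
  have h1 := hd (X (b 0)) (Fin.tail b) v
  rw [LinearMap.range_eq_bot.mp h, LinearMap.zero_apply,
    sum_mk_pderiv_X_tmul (b 0) (fun j => wedgeTensor k n (i + 1) V (Fin.cons j (Fin.tail b)) v),
    Fin.cons_self_tail] at h1
  exact one_tmul_ne_zero hq hb h1.symm

end RangeNonzero

set_option synthInstance.maxHeartbeats 1000000 in
set_option maxHeartbeats 4000000 in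
/-- Assume `char k = p > 0`.  Let `λ` be a dominant weight of `GL_n`
with mod-`p` reduction `r(λ) = ε_1+...+ε_i` (a fundamental weight, `i = i'+1`).  Then
`L(λ, G(n,r)) ≅ soc(Ω_r^i ⊗ L(s(λ))^{[1]}) = im(d_i ⊗ id)`, where
`d_i : Ω_r^{i-1} → Ω_r^i` is the de Rham differential.

Formalization via functors of points, with `Ω_r^i ⊗ L(s(λ))^{[1]} ≅
I(Λ^iU ⊗ L(s(λ))^{[1]}) = R(n,r) ⊗ (Λ^i(k^n) ⊗ V_s)` (where `V_s = L(s(λ))` is an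
irreducible algebraic `GL_n`-representation of highest weight `s(λ)`, given by the
family `σ` with hypotheses `hσnat`, `hσirr`, `hσhw`):  `ρT` is the algebraic
`GL_n`-representation `Λ^i(std) ⊗ L(s(λ))^{[1]}` (hypothesis `hT`: a matrix `M` acts
on the wedge factor through the `i×i`-minors of `M` and on the `V_s`-factor through
`σ` applied to the entrywise Frobenius `M'` of `M`, i.e. through the first Frobenius
twist), `ρI` is the corresponding `G(n,r)`-action of `I(Λ^iU ⊗ L(s(λ))^{[1]})` via
Jacobian matrices (hypothesis `hform`), and `dmap` is the (twisted) de Rham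
differential `d_i ⊗ id` (hypothesis `hd`).  Conclusion: the socle — the sum of all
irreducible invariant subspaces, invariance being tested on all points — equals the
image of `dmap`. -/
theorem stmt_14 (k : Type) [Field k] (p : ℕ) [Fact p.Prime] [CharP k p]
    (n r : ℕ) (hn : 1 ≤ n) (hr : 1 ≤ r)
    (i' : ℕ) (hi : i' + 1 ≤ n)
    (lam slam : Fin n → ℤ) (hdom : ∀ a b : Fin n, a ≤ b → lam b ≤ lam a)
    (hfund : rlam p n lam = fun j : Fin n => if (j : ℕ) < i' + 1 then (1 : ℤ) else 0)
    (hs : ∀ j, lam j = rlam p n lam j + p * slam j)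
    (Vs : Type) [AddCommGroup Vs] [Module k Vs] [FiniteDimensional k Vs]
    (σ : ∀ (B : Type) [CommRing B] [Algebra k B],
      GL (Fin n) B →* ((B ⊗[k] Vs) ≃ₗ[B] (B ⊗[k] Vs)))
    (hσnat : ∀ (B C : Type) [CommRing B] [Algebra k B] [CommRing C] [Algebra k C],
      ∀ (φ : B →ₐ[k] C) (M : GL (Fin n) B) (M' : GL (Fin n) C),
        (∀ a b, (M' : Matrix (Fin n) (Fin n) C) a b = φ ((M : Matrix (Fin n) (Fin n) B) a b)) →
        ∀ x, σ C M' (TensorProduct.map φ.toLinearMap LinearMap.id x) =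
          TensorProduct.map φ.toLinearMap LinearMap.id (σ B M x))
    (hσirr : ∀ W : Submodule k Vs,
      (∀ (B : Type) [CommRing B] [Algebra k B],
        ∀ (M : GL (Fin n) B) (w : B ⊗[k] Vs),
          w ∈ Submodule.span B (⇑(TensorProduct.mk k B Vs 1) '' (W : Set Vs)) →
          σ B M w ∈ Submodule.span B (⇑(TensorProduct.mk k B Vs 1) '' (W : Set Vs))) →
      W = ⊥ ∨ W = ⊤)
    (hσhw : ∃ v : Vs, v ≠ 0 ∧
      (∀ (B : Type) [CommRing B] [Algebra k B],
        ∀ (t : Fin n → Bˣ) (M : GL (Fin n) B),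
          (M : Matrix (Fin n) (Fin n) B) = Matrix.diagonal (fun a => (t a : B)) →
          σ B M ((1 : B) ⊗ₜ[k] v) = (∏ a, t a ^ slam a) • ((1 : B) ⊗ₜ[k] v)) ∧
      (∀ (B : Type) [CommRing B] [Algebra k B], ∀ M : GL (Fin n) B,
        (∀ a b : Fin n, b < a → (M : Matrix (Fin n) (Fin n) B) a b = 0) →
        (∀ a, (M : Matrix (Fin n) (Fin n) B) a a = 1) →
        σ B M ((1 : B) ⊗ₜ[k] v) = (1 : B) ⊗ₜ[k] v))
    (ρT : ∀ (C : Type) [CommRing C] [Algebra k C],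
      GL (Fin n) C →*
        ((C ⊗[k] ((↥(⋀[k]^(i' + 1) (Fin n → k))) ⊗[k] Vs)) ≃ₗ[C]
          (C ⊗[k] ((↥(⋀[k]^(i' + 1) (Fin n → k))) ⊗[k] Vs))))
    (hT : ∀ (C : Type) [CommRing C] [Algebra k C],
      ∀ M M' : GL (Fin n) C,
        (∀ a b, (M' : Matrix (Fin n) (Fin n) C) a b = ((M : Matrix (Fin n) (Fin n) C) a b) ^ p) →
        ∀ (a : Fin (i' + 1) → Fin n) (v : Vs),
          ρT C M ((1 : C) ⊗ₜ[k]
              (wedgeGen k n (i' + 1) (fun l => Pi.single (a l) 1) ⊗ₜ[k] v)) =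
            ∑ b ∈ Finset.univ.filter (fun b : Fin (i' + 1) → Fin n => StrictMono b),
              (((M : Matrix (Fin n) (Fin n) C).submatrix b a).det) •
                TensorProduct.map LinearMap.id
                  (TensorProduct.mk k (↥(⋀[k]^(i' + 1) (Fin n → k))) Vs
                    (wedgeGen k n (i' + 1) (fun l => Pi.single (b l) 1)))
                  (σ C M' ((1 : C) ⊗ₜ[k] v)))
    (ρI : ∀ (B : Type) [CommRing B] [Algebra k B],
      (Rq B n (p ^ r) ≃ₐ[B] Rq B n (p ^ r)) →*
        ((Rq B n (p ^ r) ⊗[k] ((↥(⋀[k]^(i' + 1) (Fin n → k))) ⊗[k] Vs)) ≃ₗ[B]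
          (Rq B n (p ^ r) ⊗[k] ((↥(⋀[k]^(i' + 1) (Fin n → k))) ⊗[k] Vs))))
    (hform : ∀ (B : Type) [CommRing B] [Algebra k B],
      ∀ (g : Rq B n (p ^ r) ≃ₐ[B] Rq B n (p ^ r)) (Pg : Fin n → MvPolynomial (Fin n) B),
        (∀ j, Ideal.Quotient.mk _ (Pg j) = g (Ideal.Quotient.mk _ (X j))) →
        ∀ J : GL (Fin n) (Rq B n (p ^ r)),
          (∀ a b, (J : Matrix (Fin n) (Fin n) (Rq B n (p ^ r))) a b =
            Ideal.Quotient.mk _ (pderiv a (Pg b))) →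
          ∀ (P : MvPolynomial (Fin n) B) (w : (↥(⋀[k]^(i' + 1) (Fin n → k))) ⊗[k] Vs),
            ρI B g (Ideal.Quotient.mk _ P ⊗ₜ[k] w) =
              ρT (Rq B n (p ^ r)) J (g (Ideal.Quotient.mk _ P) ⊗ₜ[k] w))
    (dmap : ((Rq k n (p ^ r)) ⊗[k] ((↥(⋀[k]^i' (Fin n → k))) ⊗[k] Vs)) →ₗ[k]
        ((Rq k n (p ^ r)) ⊗[k] ((↥(⋀[k]^(i' + 1) (Fin n → k))) ⊗[k] Vs)))
    (hd : ∀ (P : MvPolynomial (Fin n) k) (a : Fin i' → Fin n) (v : Vs),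
      dmap (Ideal.Quotient.mk _ P ⊗ₜ[k]
          (wedgeGen k n i' (fun l => Pi.single (a l) 1) ⊗ₜ[k] v)) =
        ∑ j : Fin n,
          Ideal.Quotient.mk _ (pderiv j P) ⊗ₜ[k]
            (wedgeGen k n (i' + 1)
                (Fin.cons (Pi.single j 1) (fun l => Pi.single (a l) 1)) ⊗ₜ[k] v)) :
    sSup {W : Submodule k ((Rq k n (p ^ r)) ⊗[k] ((↥(⋀[k]^(i' + 1) (Fin n → k))) ⊗[k] Vs)) |
        W ≠ ⊥ ∧ InvPred k n (p ^ r) (i' + 1) Vs ρI W ∧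
        ∀ W' ≤ W, InvPred k n (p ^ r) (i' + 1) Vs ρI W' → W' = ⊥ ∨ W' = W} =
      LinearMap.range dmap := by
  have hA : ActionFormula k p n (p ^ r) (i' + 1) Vs σ ρI :=
    actionFormula_of_minors σ ρT hT ρI hform
  have hσ : NaturalAction k n Vs σ := hσnat
  have hdR : IsDeRham k n (p ^ r) i' Vs dmap := by
    intro P a v
    simp only [wedgeTensor_apply, ← single_cons]
    exact hd P a v
  obtain ⟨v, hv, -⟩ := hσhw
  have : Nontrivial Vs := ⟨v, 0, hv⟩
  have hinv : InvPred k n (p ^ r) (i' + 1) Vs ρI (LinearMap.range dmap) :=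
    range_deRham_invariant (dvd_pow_self p (by omega)) hσ hA hdR
  have hbot : LinearMap.range dmap ≠ ⊥ :=
    range_deRham_ne_bot (pow_pos (Fact.out : p.Prime).pos r) hi hdR
  have hle : ∀ W, InvPred k n (p ^ r) (i' + 1) Vs ρI W → W ≠ ⊥ → LinearMap.range dmap ≤ W :=
    fun W hW hW0 => range_deRham_le hr hi hσ hσirr hA hW hW0 hdR
  apply le_antisymm
  · refine sSup_le fun W ⟨hW0, hW, hmin⟩ => ?_
    exact ((hmin _ (hle W hW hW0) hinv).resolve_left hbot).ge
  · refine le_sSup ⟨hbot, hinv, fun W' hW' hinv' => ?_⟩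
    by_cases h : W' = ⊥
    · exact Or.inl h
    · exact Or.inr (le_antisymm hW' (hle W' hinv' h))
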